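/- Let K be a miserly domain, centered at the origin, and let σ₀ : ℝ → ℝ² be an arclength parametrization of the boundary of K (which is a C¹ curve since K has no corners). Then the derivative σ₀′ is Lipschitz continuous. -/

import Mathlib

open MeasureTheory

noncomputable section

/-- The wedge (cross) product of two planar vectors. -/
def wedge (v w : ℝ × ℝ) : ℝ := v.1 * w.2 - v.2 * w.1

/-- A centrally symmetric convex domain in the plane. -/
def IsCSCD (K : Set (ℝ × ℝ)) : Prop :=
  Convex ℝ K ∧ IsCompact K ∧ (interior K).Nonempty ∧ K = -K

/-- The lattice spanned over `ℤ` by the vectors `v` and `w`. -/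
def latticeOf (v w : ℝ × ℝ) : Set (ℝ × ℝ) :=
  {p | ∃ m n : ℤ, p = (m : ℝ) • v + (n : ℝ) • w}

/-- `Λ + K` is a packing of `K`. -/
def IsPacking (K Λ : Set (ℝ × ℝ)) : Prop :=
  ∀ p ∈ Λ, ∀ q ∈ Λ, p ≠ q →
    interior ((fun x => p + x) '' K) ∩ interior ((fun x => q + x) '' K) = ∅

/-- The set of densities of lattice packings of `K`. -/
def packingDensities (K : Set (ℝ × ℝ)) : Set ℝ :=
  {d | ∃ v w : ℝ × ℝ, wedge v w ≠ 0 ∧ IsPacking K (latticeOf v w) ∧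
       d = (volume K).toReal / |wedge v w|}

/-- `δ_lat(K)`: the supremum of densities of lattice packings of `K`. -/
def deltaLat (K : Set (ℝ × ℝ)) : ℝ := sSup (packingDensities K)

/-- A miserly domain: a centrally symmetric convex domain minimizing `δ_lat`. -/
def IsMiserly (K : Set (ℝ × ℝ)) : Prop :=
  IsCSCD K ∧ ∀ K' : Set (ℝ × ℝ), IsCSCD K' → deltaLat K ≤ deltaLat K'

open Filter Topology Set

section Wedge

variable (a b c : ℝ × ℝ) (r : ℝ)

lemma wedge_add_left : wedge (a + b) c = wedge a c + wedge b c := by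
  simp only [wedge, Prod.fst_add, Prod.snd_add]; ring

lemma wedge_add_right : wedge a (b + c) = wedge a b + wedge a c := by
  simp only [wedge, Prod.fst_add, Prod.snd_add]; ring

lemma wedge_sub_left : wedge (a - b) c = wedge a c - wedge b c := by
  simp only [wedge, Prod.fst_sub, Prod.snd_sub]; ring

lemma wedge_sub_right : wedge a (b - c) = wedge a b - wedge a c := by
  simp only [wedge, Prod.fst_sub, Prod.snd_sub]; ring

lemma wedge_neg_left : wedge (-a) b = -wedge a b := by
  simp only [wedge, Prod.fst_neg, Prod.snd_neg]; ring

lemma wedge_neg_right : wedge a (-b) = -wedge a b := by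
  simp only [wedge, Prod.fst_neg, Prod.snd_neg]; ring

lemma wedge_smul_left : wedge (r • a) b = r * wedge a b := by
  simp only [wedge, Prod.smul_fst, Prod.smul_snd, smul_eq_mul]; ring

lemma wedge_smul_right : wedge a (r • b) = r * wedge a b := by
  simp only [wedge, Prod.smul_fst, Prod.smul_snd, smul_eq_mul]; ring

lemma wedge_self : wedge a a = 0 := by
  simp only [wedge]; ring

lemma wedge_zero_left : wedge 0 a = 0 := by
  simp [wedge]

lemma wedge_comm_neg : wedge a b = -wedge b a := by
  simp only [wedge]; ring

/-- Cramer rule: expansion of a vector in terms of two others. -/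
lemma wedge_smul_eq : wedge a b • c = wedge c b • a + wedge a c • b := by
  ext <;> simp [wedge] <;> ring

lemma abs_wedge_le : |wedge a b| ≤ 2 * ‖a‖ * ‖b‖ := by
  have h1 := norm_fst_le a
  have h2 := norm_snd_le a
  have h3 := norm_fst_le b
  have h4 := norm_snd_le b
  have e1 : |a.1 * b.2| ≤ ‖a‖ * ‖b‖ := by
    rw [abs_mul]; exact mul_le_mul h1 h4 (abs_nonneg _) (norm_nonneg _)
  have e2 : |a.2 * b.1| ≤ ‖a‖ * ‖b‖ := by
    rw [abs_mul]; exact mul_le_mul h2 h3 (abs_nonneg _) (norm_nonneg _)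
  calc |wedge a b| ≤ |a.1 * b.2| + |a.2 * b.1| := abs_sub _ _
    _ ≤ _ := by linarith

end Wedge

@[fun_prop]
lemma Continuous.wedge {X : Type*} [TopologicalSpace X] {f g : X → ℝ × ℝ}
    (hf : Continuous f) (hg : Continuous g) : Continuous fun x => wedge (f x) (g x) := by
  unfold _root_.wedge
  fun_prop

/-- Every linear functional on the plane is a wedge product with a fixed vector. -/
lemma exists_eq_wedge (f : ℝ × ℝ →L[ℝ] ℝ) : ∃ l : ℝ × ℝ, ∀ x, f x = wedge x l := by
  refine ⟨(-f (0, 1), f (1, 0)), fun x => ?_⟩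
  have hx : x = x.1 • (1, 0) + x.2 • (0, 1) := by ext <;> simp
  conv_lhs => rw [hx]
  rw [map_add, map_smul, map_smul]
  simp only [wedge, smul_eq_mul]
  ring

/-- Unit vectors for the sup norm that are close have distance controlled by their wedge. -/
lemma norm_sub_le_abs_wedge {a b : ℝ × ℝ} (ha : ‖a‖ = 1) (hb : ‖b‖ = 1) (hab : ‖b - a‖ < 1) :
    ‖b - a‖ ≤ |wedge a b| := by
  have key : ∀ x y u v : ℝ, |x| ≤ 1 → |y| ≤ 1 → |u| ≤ 1 → |v| ≤ 1 → (|x| = 1 ∨ |y| = 1) →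
      (|u| = 1 ∨ |v| = 1) → |u - x| < 1 → |v - y| < 1 →
      |u - x| ≤ |x * v - y * u| ∧ |v - y| ≤ |x * v - y * u| := by
    intro x y u v hx hy hu hv h1 h2 h3 h4
    rw [abs_le] at hx hy hu hv
    rw [abs_lt] at h3 h4
    have hs : ∀ z : ℝ, |z| = 1 → z = 1 ∨ z = -1 := fun z hz => eq_or_eq_neg_of_abs_eq hz
    constructor
    · rcases h1 with h1 | h1 <;> rcases h2 with h2 | h2 <;>
      rcases hs _ h1 with rfl | rfl <;> rcases hs _ h2 with rfl | rfl <;>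
      rw [abs_le] <;> constructor <;>
      first
      | linarith [abs_nonneg (1 * v - y * 1), abs_nonneg (-1 * v - y * -1)]
      | (refine le_abs.2 (Or.inl ?_); nlinarith)
      | (refine le_abs.2 (Or.inr ?_); nlinarith)
      | (refine neg_le.1 (le_abs.2 (Or.inl ?_)); nlinarith)
      | (refine neg_le.1 (le_abs.2 (Or.inr ?_)); nlinarith)
    · rcases h1 with h1 | h1 <;> rcases h2 with h2 | h2 <;>
      rcases hs _ h1 with rfl | rfl <;> rcases hs _ h2 with rfl | rfl <;>
      rw [abs_le] <;> constructor <;>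
      first
      | linarith [abs_nonneg (x * 1 - 1 * u), abs_nonneg (x * -1 - -1 * u)]
      | (refine le_abs.2 (Or.inl ?_); nlinarith)
      | (refine le_abs.2 (Or.inr ?_); nlinarith)
      | (refine neg_le.1 (le_abs.2 (Or.inl ?_)); nlinarith)
      | (refine neg_le.1 (le_abs.2 (Or.inr ?_)); nlinarith)
  have h1 : ∀ c : ℝ × ℝ, ‖c‖ = 1 → |c.1| ≤ 1 ∧ |c.2| ≤ 1 ∧ (|c.1| = 1 ∨ |c.2| = 1) := by
    intro c hc
    rw [Prod.norm_def] at hc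
    simp only [Real.norm_eq_abs] at hc
    refine ⟨hc ▸ le_max_left _ _, hc ▸ le_max_right _ _, ?_⟩
    rcases max_choice |c.1| |c.2| with h | h
    · left; rw [← h, hc]
    · right; rw [← h, hc]
  obtain ⟨a1, a2, a3⟩ := h1 a ha
  obtain ⟨b1, b2, b3⟩ := h1 b hb
  have := key a.1 a.2 b.1 b.2 a1 a2 b1 b2 a3 b3 ((norm_fst_le (b - a)).trans_lt hab)
    ((norm_snd_le (b - a)).trans_lt hab)
  exact max_le this.1 this.2

namespace IsCSCD

variable {K : Set (ℝ × ℝ)}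

lemma neg_mem (hK : IsCSCD K) {x : ℝ × ℝ} (hx : x ∈ K) : -x ∈ K := by
  have h := hK.2.2.2
  rw [h] at hx
  simpa using hx

lemma mem_nhds (hK : IsCSCD K) : K ∈ 𝓝 (0 : ℝ × ℝ) := by
  obtain ⟨x, hx⟩ := hK.2.2.1
  have hneg : -x ∈ K := hK.neg_mem (interior_subset hx)
  have h := hK.1.combo_interior_self_mem_interior hx hneg (a := 1 / 2) (b := 1 / 2)
    (by norm_num) (by norm_num) (by norm_num)
  rw [smul_neg, add_neg_cancel] at h
  exact mem_interior_iff_mem_nhds.1 h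

lemma gauge_neg (hK : IsCSCD K) (x : ℝ × ℝ) : gauge K (-x) = gauge K x :=
  _root_.gauge_neg (fun _ => hK.neg_mem) x

lemma gauge_smul (hK : IsCSCD K) (r : ℝ) (x : ℝ × ℝ) : gauge K (r • x) = |r| * gauge K x := by
  rcases le_total 0 r with hr | hr
  · rw [gauge_smul_of_nonneg hr, abs_of_nonneg hr, smul_eq_mul]
  · rw [← hK.gauge_neg, ← neg_smul, gauge_smul_of_nonneg (neg_nonneg.2 hr), abs_of_nonpos hr,
      smul_eq_mul]

lemma gauge_add_le (hK : IsCSCD K) (x y : ℝ × ℝ) : gauge K (x + y) ≤ gauge K x + gauge K y :=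
  _root_.gauge_add_le hK.1 (absorbent_nhds_zero hK.mem_nhds) x y

lemma gauge_sub_le (hK : IsCSCD K) (x y : ℝ × ℝ) : gauge K (x - y) ≤ gauge K x + gauge K y := by
  rw [sub_eq_add_neg, ← hK.gauge_neg y]
  exact hK.gauge_add_le _ _

lemma continuous_gauge (hK : IsCSCD K) : Continuous (gauge K) :=
  _root_.continuous_gauge hK.1 hK.mem_nhds

lemma gauge_le_one_iff (hK : IsCSCD K) {x : ℝ × ℝ} : gauge K x ≤ 1 ↔ x ∈ K := by
  rw [gauge_le_one_iff_mem_closure hK.1 hK.mem_nhds, hK.2.1.isClosed.closure_eq]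

lemma gauge_lt_one_iff (hK : IsCSCD K) {x : ℝ × ℝ} : gauge K x < 1 ↔ x ∈ interior K :=
  gauge_lt_one_iff_mem_interior hK.1 hK.mem_nhds

lemma gauge_eq_one_iff (hK : IsCSCD K) {x : ℝ × ℝ} : gauge K x = 1 ↔ x ∈ frontier K :=
  gauge_eq_one_iff_mem_frontier hK.1 hK.mem_nhds

lemma gauge_pos (hK : IsCSCD K) {x : ℝ × ℝ} (hx : x ≠ 0) : 0 < gauge K x :=
  (_root_.gauge_pos (absorbent_nhds_zero hK.mem_nhds)
    ((NormedSpace.isVonNBounded_iff ℝ).2 hK.2.1.isBounded)).2 hx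

lemma exists_norm_le (hK : IsCSCD K) : ∃ R : ℝ, 0 < R ∧ ∀ x ∈ K, ‖x‖ ≤ R := by
  obtain ⟨R, hR⟩ := hK.2.1.isBounded.exists_norm_le
  exact ⟨max R 1, by positivity, fun x hx => (hR x hx).trans (le_max_left _ _)⟩

end IsCSCD

/-- The polar of `K`, with functionals represented through the wedge product. -/
def wedgePolar (K : Set (ℝ × ℝ)) : Set (ℝ × ℝ) := {l | ∀ y ∈ K, wedge y l ≤ 1}

namespace IsCSCD

variable {K : Set (ℝ × ℝ)}

lemma wedge_le_gauge (hK : IsCSCD K) {l : ℝ × ℝ} (hl : l ∈ wedgePolar K) (y : ℝ × ℝ) :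
    wedge y l ≤ gauge K y := by
  refine le_of_forall_gt fun r hr => ?_
  obtain ⟨b, hb, hbr, z, hz, rfl⟩ :=
    exists_lt_of_gauge_lt (absorbent_nhds_zero hK.mem_nhds) hr
  have := hl z hz
  change wedge (b • z) l < r
  rw [wedge_smul_left]
  nlinarith

lemma abs_wedge_le_gauge (hK : IsCSCD K) {l : ℝ × ℝ} (hl : l ∈ wedgePolar K) (y : ℝ × ℝ) :
    |wedge y l| ≤ gauge K y := by
  refine abs_le.2 ⟨?_, hK.wedge_le_gauge hl y⟩
  have := hK.wedge_le_gauge hl (-y)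
  rw [hK.gauge_neg, wedge_neg_left] at this
  linarith

lemma exists_polar_bound (hK : IsCSCD K) : ∃ L : ℝ, 0 < L ∧ ∀ l ∈ wedgePolar K, ‖l‖ ≤ L := by
  refine ⟨max (max (gauge K (0, 1)) (gauge K (1, 0))) 1, by positivity, fun l hl => ?_⟩
  have h1 := hK.abs_wedge_le_gauge hl (0, 1)
  have h2 := hK.abs_wedge_le_gauge hl (1, 0)
  simp only [wedge, zero_mul, one_mul, zero_sub, abs_neg, sub_zero] at h1 h2
  refine le_trans ?_ (le_max_left _ _)
  exact max_le_max h1 h2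

lemma isCompact_wedgePolar (hK : IsCSCD K) : IsCompact (wedgePolar K) := by
  obtain ⟨L, -, hL⟩ := hK.exists_polar_bound
  refine Metric.isCompact_of_isClosed_isBounded ?_ (isBounded_iff_forall_norm_le.2 ⟨L, hL⟩)
  have : wedgePolar K = ⋂ y ∈ K, {l | wedge y l ≤ 1} := by
    ext l; simp [wedgePolar]
  rw [this]
  exact isClosed_biInter fun y _ => isClosed_le (by fun_prop) continuous_const

/-- A point outside the interior of `K` is separated from `K` by an element of the polar. -/
lemma exists_mem_wedgePolar (hK : IsCSCD K) {x : ℝ × ℝ} (hx : 1 ≤ gauge K x) :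
    ∃ l ∈ wedgePolar K, wedge x l = 1 := by
  have hx' : x ∉ interior K := fun h => not_lt.2 hx (hK.gauge_lt_one_iff.2 h)
  obtain ⟨f, hf⟩ := geometric_hahn_banach_open_point hK.1.interior isOpen_interior hx'
  have hpos : 0 < f x := by
    simpa using hf 0 (mem_interior_iff_mem_nhds.2 hK.mem_nhds)
  obtain ⟨l, hl⟩ := exists_eq_wedge f
  refine ⟨(f x)⁻¹ • l, fun y hy => ?_, ?_⟩
  · have hy' : y ∈ closure (interior K) := by
      rw [hK.1.closure_interior_eq_closure_of_nonempty_interior hK.2.2.1]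
      exact subset_closure hy
    rw [wedge_smul_right, ← hl, inv_mul_le_iff₀ hpos, mul_one]
    have : closure (interior K) ⊆ {z | f z ≤ f x} :=
      closure_minimal (fun z hz => (hf z hz).le) (isClosed_le f.continuous continuous_const)
    exact this hy'
  · rw [wedge_smul_right, ← hl, inv_mul_cancel₀ hpos.ne']

end IsCSCD

/-- `p`, `q` and `-(p + q)` all lie on the boundary of `K`. -/
def IsInscribed (K : Set (ℝ × ℝ)) (p q : ℝ × ℝ) : Prop :=
  gauge K p = 1 ∧ gauge K q = 1 ∧ gauge K (p + q) = 1

/-- No nonzero integral combination of `v` and `w` lies in the interior of `K`. -/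
def IsAdmissible (K : Set (ℝ × ℝ)) (v w : ℝ × ℝ) : Prop :=
  ∀ m n : ℤ, (m ≠ 0 ∨ n ≠ 0) → 1 ≤ gauge K ((m : ℝ) • v + (n : ℝ) • w)

namespace IsCSCD

variable {K : Set (ℝ × ℝ)}

lemma exists_isInscribed (hK : IsCSCD K) {u w : ℝ × ℝ} (hu : gauge K u = 1)
    (hw : 0 < wedge u w) : ∃ q, IsInscribed K u q ∧ 0 < wedge u q := by
  have hu0 : u ≠ 0 := by rintro rfl; simp at hu
  set y : ℝ → ℝ × ℝ := fun s => (1 - 2 * s) • u + (s * (1 - s)) • w with hy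
  have hwy : ∀ s, wedge u (y s) = s * (1 - s) * wedge u w := fun s => by
    simp only [hy, wedge_add_right, wedge_smul_right, wedge_self]; ring
  have hy0 : ∀ s, y s ≠ 0 := by
    intro s hs
    have h := hwy s
    rw [hs] at h
    have h0 : s * (1 - s) = 0 := by
      have : wedge u 0 = 0 := by simp [wedge]
      rw [this] at h
      rcases mul_eq_zero.1 h.symm with h | h
      · exact h
      · exact absurd h hw.ne'
    have h1 : (1 - 2 * s) • u = 0 := by
      have := hs
      simp only [hy, h0, zero_smul, add_zero] at this
      exact this
    rcases smul_eq_zero.1 h1 with h1 | h1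
    · have : s = 1 / 2 := by linarith
      rw [this] at h0; norm_num at h0
    · exact hu0 h1
  have hyc : Continuous y := by fun_prop
  have hg : Continuous fun s => gauge K (y s) := hK.continuous_gauge.comp hyc
  have hgpos : ∀ s, 0 < gauge K (y s) := fun s => hK.gauge_pos (hy0 s)
  set f : ℝ → ℝ := fun s => gauge K ((gauge K (y s))⁻¹ • y s - u) with hf
  have hfc : Continuous f := by
    have h1 : Continuous fun s => (gauge K (y s))⁻¹ • y s :=
      (hg.inv₀ fun s => (hgpos s).ne').smul hyc
    exact hK.continuous_gauge.comp (h1.sub continuous_const)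
  have hf0 : f 0 = 0 := by simp [hf, hy, hu]
  have hf1 : f 1 = 2 := by
    have : y 1 = -u := by simp only [hy]; norm_num
    simp only [hf, this, hK.gauge_neg, hu]
    rw [inv_one, one_smul, ← neg_add', hK.gauge_neg, ← two_smul ℝ u, hK.gauge_smul, hu]
    norm_num
  obtain ⟨s, hs, hs1⟩ := intermediate_value_Icc zero_le_one hfc.continuousOn
    (show (1 : ℝ) ∈ Icc (f 0) (f 1) by rw [hf0, hf1]; constructor <;> norm_num)
  have hs0 : s ≠ 0 := by rintro rfl; rw [hf0] at hs1; norm_num at hs1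
  have hs2 : s ≠ 1 := by rintro rfl; rw [hf1] at hs1; norm_num at hs1
  have hspos : 0 < s := lt_of_le_of_ne hs.1 hs0.symm
  have hslt : 0 < 1 - s := sub_pos.2 (lt_of_le_of_ne hs.2 hs2)
  refine ⟨(gauge K (y s))⁻¹ • y s - u, ⟨hu, hs1, ?_⟩, ?_⟩
  · rw [add_sub_cancel, hK.gauge_smul, abs_of_pos (inv_pos.2 (hgpos s)),
      inv_mul_cancel₀ (hgpos s).ne']
  · rw [wedge_sub_right, wedge_self, sub_zero, wedge_smul_right, hwy]
    have := hgpos s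
    positivity

/-- A row of points outside the interior of `K` lies above an inscribed pair. -/
lemma wedge_le_of_row (hK : IsCSCD K) {u q z : ℝ × ℝ} (h : IsInscribed K u q)
    (huq : 0 < wedge u q) (huz : 0 < wedge u z)
    (hz : ∀ k : ℤ, 1 ≤ gauge K (z + (k : ℝ) • u)) : wedge u q ≤ wedge u z := by
  by_contra! hlt
  obtain ⟨h1, h2, h3⟩ := h
  set s := wedge u z / wedge u q with hs
  set c := wedge z q / wedge u q with hc
  have hs0 : 0 < s := by positivity
  have hs1 : s < 1 := (div_lt_one huq).2 hlt
  have hzeq : z = c • u + s • q := by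
    have := wedge_smul_eq u q z
    rw [hc, hs, div_eq_inv_mul, div_eq_inv_mul, mul_smul, mul_smul, ← smul_add, ← this,
      smul_smul, inv_mul_cancel₀ huq.ne', one_smul]
  have key := hz (-⌊c⌋)
  have e0 := Int.fract_nonneg c
  have e1 := Int.fract_lt_one c
  have hpt : z + ((-⌊c⌋ : ℤ) : ℝ) • u = Int.fract c • u + s • q := by
    rw [hzeq, Int.fract]; push_cast; module
  rw [hpt] at key
  set e := Int.fract c
  rcases le_total e s with hes | hes
  · have : e • u + s • q = (s - e) • q + e • (u + q) := by module
    rw [this] at key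
    have h4 := hK.gauge_add_le ((s - e) • q) (e • (u + q))
    rw [hK.gauge_smul, hK.gauge_smul, h2, h3, abs_of_nonneg e0, abs_of_nonneg (sub_nonneg.2 hes)]
      at h4
    linarith
  · have : e • u + s • q = s • (u + q) + (e - s) • u := by module
    rw [this] at key
    have h4 := hK.gauge_add_le (s • (u + q)) ((e - s) • u)
    rw [hK.gauge_smul, hK.gauge_smul, h1, h3, abs_of_pos hs0, abs_of_nonneg (sub_nonneg.2 hes)]
      at h4
    linarith

lemma norm_le_mul_gauge (hK : IsCSCD K) : ∃ R : ℝ, 0 < R ∧ ∀ x, ‖x‖ ≤ R * gauge K x := by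
  obtain ⟨R, hR, hb⟩ := hK.exists_norm_le
  refine ⟨R, hR, fun x => ?_⟩
  rcases eq_or_ne x 0 with rfl | hx
  · simp
  have hg := hK.gauge_pos hx
  have := hb ((gauge K x)⁻¹ • x) (hK.gauge_le_one_iff.1 (by
    rw [hK.gauge_smul, abs_of_pos (inv_pos.2 hg), inv_mul_cancel₀ hg.ne']))
  rwa [norm_smul, norm_inv, Real.norm_of_nonneg hg.le, inv_mul_le_iff₀ hg, mul_comm] at this

lemma finite_lattice_gauge_le (hK : IsCSCD K) {v w : ℝ × ℝ} (h : wedge v w ≠ 0) (M : ℝ) :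
    {m : ℤ × ℤ | gauge K ((m.1 : ℝ) • v + (m.2 : ℝ) • w) ≤ M}.Finite := by
  obtain ⟨R, hR, hb⟩ := hK.norm_le_mul_gauge
  set B := (2 * (R * M) * (‖v‖ + ‖w‖)) / |wedge v w| with hB
  have hpos : 0 < |wedge v w| := abs_pos.2 h
  refine ((Set.finite_Icc (-⌈B⌉) ⌈B⌉).prod (Set.finite_Icc (-⌈B⌉) ⌈B⌉)).subset ?_
  have hmemIcc : ∀ k : ℤ, |(k : ℝ)| ≤ B → k ∈ Icc (-⌈B⌉) ⌈B⌉ := by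
    intro k hk
    have hk' := abs_le.1 (hk.trans (Int.le_ceil B))
    exact ⟨by exact_mod_cast hk'.1, by exact_mod_cast hk'.2⟩
  rintro ⟨m, n⟩ hmn
  change gauge K ((m : ℝ) • v + (n : ℝ) • w) ≤ M at hmn
  set y := (m : ℝ) • v + (n : ℝ) • w with hy
  have hyn : ‖y‖ ≤ R * M := (hb y).trans (mul_le_mul_of_nonneg_left hmn hR.le)
  have e1 : wedge y w = m * wedge v w := by
    rw [hy, wedge_add_left, wedge_smul_left, wedge_smul_left, wedge_self]; ring
  have e2 : wedge v y = n * wedge v w := by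
    rw [hy, wedge_add_right, wedge_smul_right, wedge_smul_right, wedge_self]; ring
  have hv := norm_nonneg v
  have hw := norm_nonneg w
  have hyy := norm_nonneg y
  constructor
  · refine hmemIcc m ?_
    rw [hB, le_div_iff₀ hpos, ← abs_mul, ← e1]
    refine (abs_wedge_le y w).trans ?_
    nlinarith [mul_le_mul_of_nonneg_right hyn hw, mul_le_mul_of_nonneg_right hyn hv,
      mul_nonneg hyy hv]
  · refine hmemIcc n ?_
    rw [hB, le_div_iff₀ hpos, ← abs_mul, ← e2]
    refine (abs_wedge_le v y).trans ?_
    nlinarith [mul_le_mul_of_nonneg_right hyn hw, mul_le_mul_of_nonneg_right hyn hv,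
      mul_nonneg hyy hw]

lemma exists_isInscribed_wedge_le_of_pos (hK : IsCSCD K) {v w : ℝ × ℝ} (h : 0 < wedge v w)
    (hA : IsAdmissible K v w) : ∃ u q, IsInscribed K u q ∧ 0 < wedge u q ∧
      wedge u q ≤ wedge v w := by
  set f : ℤ × ℤ → ℝ := fun m => gauge K ((m.1 : ℝ) • v + (m.2 : ℝ) • w) with hf
  set T : Set (ℤ × ℤ) := {m | IsCoprime m.1 m.2 ∧ f m ≤ f (1, 0)} with hT
  have hfin : T.Finite := (hK.finite_lattice_gauge_le h.ne' (f (1, 0))).subset fun m hm => hm.2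
  have hne : T.Nonempty := ⟨(1, 0), isCoprime_one_left, le_rfl⟩
  obtain ⟨⟨m, n⟩, ⟨hcop, hle⟩, hmin⟩ := Set.exists_min_image T f hfin hne
  have hmin' : ∀ m' : ℤ × ℤ, IsCoprime m'.1 m'.2 → f (m, n) ≤ f m' := by
    intro m' hm'
    rcases le_total (f m') (f (1, 0)) with h' | h'
    · exact hmin m' ⟨hm', h'⟩
    · exact hle.trans h'
  obtain ⟨a, b, hab⟩ := hcop
  simp only at hab
  have hmn : m ≠ 0 ∨ n ≠ 0 := by
    by_contra! hc
    simp [hc.1, hc.2] at hab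
  have hg1 : 1 ≤ f (m, n) := hA m n hmn
  set g := f (m, n) with hg
  have hg0 : 0 < g := one_pos.trans_le hg1
  set u0 := (m : ℝ) • v + (n : ℝ) • w with hu0
  set z0 := (-b : ℝ) • v + (a : ℝ) • w with hz0
  have habR : (a : ℝ) * m + b * n = 1 := by exact_mod_cast hab
  have hwz : wedge u0 z0 = wedge v w := by
    rw [hu0, hz0]
    simp only [wedge_add_left, wedge_add_right, wedge_smul_left, wedge_smul_right, wedge_self]
    rw [wedge_comm_neg w v]
    linear_combination wedge v w * habR
  have hrow : ∀ k : ℤ, 1 ≤ gauge K (g⁻¹ • z0 + (k : ℝ) • (g⁻¹ • u0)) := by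
    intro k
    have hcop' : IsCoprime (k * m - b) (k * n + a) := ⟨-n, m, by linear_combination hab⟩
    have hk := hmin' (k * m - b, k * n + a) hcop'
    have : g⁻¹ • z0 + (k : ℝ) • (g⁻¹ • u0) =
        g⁻¹ • (((k * m - b : ℤ) : ℝ) • v + ((k * n + a : ℤ) : ℝ) • w) := by
      rw [hz0, hu0]; push_cast; module
    rw [this, hK.gauge_smul, abs_of_pos (inv_pos.2 hg0), ← div_eq_inv_mul, one_le_div hg0]
    exact hk
  have hgu : gauge K (g⁻¹ • u0) = 1 := by
    rw [hK.gauge_smul, abs_of_pos (inv_pos.2 hg0)]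
    exact inv_mul_cancel₀ hg0.ne'
  have hww : wedge (g⁻¹ • u0) (g⁻¹ • z0) = g⁻¹ * (g⁻¹ * wedge v w) := by
    rw [wedge_smul_left, wedge_smul_right, hwz]
  have hpos : 0 < wedge (g⁻¹ • u0) (g⁻¹ • z0) := by rw [hww]; positivity
  obtain ⟨q, hq, hqpos⟩ := hK.exists_isInscribed hgu hpos
  refine ⟨_, q, hq, hqpos, (hK.wedge_le_of_row hq hqpos hpos hrow).trans ?_⟩
  rw [hww]
  have hg2 : g⁻¹ ≤ 1 := inv_le_one_of_one_le₀ hg1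
  have hg3 : 0 < g⁻¹ := inv_pos.2 hg0
  nlinarith [mul_pos hg3 h]

lemma exists_isInscribed_abs_wedge_le (hK : IsCSCD K) {v w : ℝ × ℝ} (h : wedge v w ≠ 0)
    (hA : IsAdmissible K v w) : ∃ u q, IsInscribed K u q ∧ |wedge u q| ≤ |wedge v w| := by
  rcases lt_or_gt_of_ne h with h | h
  · have hA' : IsAdmissible K v (-w) := fun m n hmn => by
      have := hA m (-n) (hmn.imp_right neg_ne_zero.2)
      rwa [Int.cast_neg, neg_smul, ← smul_neg] at this
    obtain ⟨u, q, h1, h2, h3⟩ := hK.exists_isInscribed_wedge_le_of_pos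
      (by rw [wedge_neg_right]; linarith) hA'
    rw [wedge_neg_right] at h3
    exact ⟨u, q, h1, by rw [abs_of_pos h2, abs_of_neg h]; exact h3⟩
  · obtain ⟨u, q, h1, h2, h3⟩ := hK.exists_isInscribed_wedge_le_of_pos h hA
    exact ⟨u, q, h1, by rw [abs_of_pos h2, abs_of_pos h]; exact h3⟩

/-- Admissibility of the lattice of midpoints of a circumscribed hexagon. -/
lemma isAdmissible_of_polar (hK : IsCSCD K) {p q l₀ l₁ l₂ : ℝ × ℝ} (h₀ : l₀ ∈ wedgePolar K)
    (h₁ : l₁ ∈ wedgePolar K) (h₂ : l₂ ∈ wedgePolar K)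
    (hp₀ : 1 ≤ wedge p l₀) (hq₀ : wedge q l₀ ≤ 0)
    (hq₁ : 1 ≤ wedge q l₁)
    (hp₂ : 0 ≤ wedge p l₂) (hq₂ : 0 ≤ wedge q l₂) (hpq : 1 ≤ wedge (p + q) l₂) :
    IsAdmissible K p q := by
  intro m n hmn
  have key : ∀ l ∈ wedgePolar K, |m * wedge p l + n * wedge q l| ≤
      gauge K ((m : ℝ) • p + (n : ℝ) • q) := fun l hl => by
    have := hK.abs_wedge_le_gauge hl ((m : ℝ) • p + (n : ℝ) • q)
    rwa [wedge_add_left, wedge_smul_left, wedge_smul_left] at this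
  rw [wedge_add_left] at hpq
  rcases lt_trichotomy m 0 with hm | rfl | hm
  · have hm' : (m : ℝ) ≤ -1 := by exact_mod_cast Int.le_sub_one_of_lt hm
    rcases lt_or_ge n 0 with hn | hn
    · have hn' : (n : ℝ) ≤ -1 := by exact_mod_cast Int.le_sub_one_of_lt hn
      refine le_trans (le_abs.2 (Or.inr ?_)) (key l₂ h₂)
      nlinarith
    · have hn' : (0 : ℝ) ≤ n := by exact_mod_cast hn
      refine le_trans (le_abs.2 (Or.inr ?_)) (key l₀ h₀)
      nlinarith
  · have hn : n ≠ 0 := by simpa using hmn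
    refine le_trans ?_ (key l₁ h₁)
    have h1 : (1 : ℝ) ≤ |(n : ℝ)| := by exact_mod_cast Int.one_le_abs hn
    rw [Int.cast_zero, zero_mul, zero_add, abs_mul]
    nlinarith [le_abs_self (wedge q l₁), abs_nonneg (wedge q l₁)]
  · have hm' : (1 : ℝ) ≤ m := by exact_mod_cast hm
    rcases lt_or_ge 0 n with hn | hn
    · have hn' : (1 : ℝ) ≤ n := by exact_mod_cast hn
      refine le_trans (le_abs.2 (Or.inl ?_)) (key l₂ h₂)
      nlinarith
    · have hn' : (n : ℝ) ≤ 0 := by exact_mod_cast hn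
      refine le_trans (le_abs.2 (Or.inl ?_)) (key l₀ h₀)
      nlinarith

end IsCSCD

lemma IsInscribed.symm {K : Set (ℝ × ℝ)} {p q : ℝ × ℝ} (h : IsInscribed K p q) :
    IsInscribed K q p := ⟨h.2.1, h.1, by rw [add_comm]; exact h.2.2⟩

lemma IsInscribed.rotate {K : Set (ℝ × ℝ)} (hK : IsCSCD K) {p q : ℝ × ℝ}
    (h : IsInscribed K p q) : IsInscribed K q (-(p + q)) := by
  refine ⟨h.2.1, by rw [hK.gauge_neg]; exact h.2.2, ?_⟩
  have : q + -(p + q) = -p := by module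
  rw [this, hK.gauge_neg]
  exact h.1

namespace IsCSCD

variable {K : Set (ℝ × ℝ)}

lemma isAdmissible_of_isInscribed (hK : IsCSCD K) {p q : ℝ × ℝ} (h : IsInscribed K p q) :
    IsAdmissible K p q := by
  obtain ⟨h1, h2, h3⟩ := h
  obtain ⟨l₀, hl₀, e₀⟩ := hK.exists_mem_wedgePolar h1.ge
  obtain ⟨l₁, hl₁, e₁⟩ := hK.exists_mem_wedgePolar h2.ge
  obtain ⟨l₂, hl₂, e₂⟩ := hK.exists_mem_wedgePolar h3.ge
  have a0 := hK.wedge_le_gauge hl₀ (p + q)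
  have a2 := hK.wedge_le_gauge hl₂ p
  have a3 := hK.wedge_le_gauge hl₂ q
  refine hK.isAdmissible_of_polar hl₀ hl₁ hl₂ e₀.ge ?_ e₁.ge ?_ ?_ e₂.ge <;>
  rw [wedge_add_left] at * <;> linarith

lemma wedge_ne_zero_of_isInscribed (hK : IsCSCD K) {p q : ℝ × ℝ} (h : IsInscribed K p q) :
    wedge p q ≠ 0 := by
  intro h0
  obtain ⟨h1, h2, h3⟩ := h
  obtain ⟨l, hl, e⟩ := hK.exists_mem_wedgePolar h1.ge
  have hq : q = wedge q l • p := by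
    have := wedge_smul_eq p l q
    rwa [e, h0, one_smul, zero_smul, add_zero] at this
  set c := wedge q l
  have h3' : p + q = (1 + c) • p := by rw [add_smul, one_smul, ← hq]
  rw [h3', hK.gauge_smul, h1, mul_one] at h3
  rw [hq, hK.gauge_smul, h1, mul_one] at h2
  rcases eq_or_eq_neg_of_abs_eq h2 with hc | hc <;> rw [hc] at h3 <;> norm_num at h3

lemma isCompact_isInscribed (hK : IsCSCD K) :
    IsCompact {x : (ℝ × ℝ) × (ℝ × ℝ) | IsInscribed K x.1 x.2} := by
  have hc := hK.continuous_gauge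
  refine (hK.2.1.prod hK.2.1).of_isClosed_subset ?_ fun x hx =>
    ⟨hK.gauge_le_one_iff.1 hx.1.le, hK.gauge_le_one_iff.1 hx.2.1.le⟩
  exact (isClosed_eq (hc.comp continuous_fst) continuous_const).inter
    ((isClosed_eq (hc.comp continuous_snd) continuous_const).inter
      (isClosed_eq (hc.comp (continuous_fst.add continuous_snd)) continuous_const))

end IsCSCD

/-- The smallest covolume of an inscribed pair. -/
def inscribedDet (K : Set (ℝ × ℝ)) : ℝ :=
  sInf ((fun x : (ℝ × ℝ) × (ℝ × ℝ) => |wedge x.1 x.2|) '' {x | IsInscribed K x.1 x.2})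

namespace IsCSCD

variable {K : Set (ℝ × ℝ)}

lemma inscribedDet_le_of_isInscribed {p q : ℝ × ℝ} (h : IsInscribed K p q) :
    inscribedDet K ≤ |wedge p q| :=
  csInf_le ⟨0, by rintro _ ⟨x, -, rfl⟩; exact abs_nonneg _⟩ ⟨(p, q), h, rfl⟩

lemma exists_inscribedDet (hK : IsCSCD K) :
    ∃ p q, IsInscribed K p q ∧ |wedge p q| = inscribedDet K := by
  have hne : {x : (ℝ × ℝ) × (ℝ × ℝ) | IsInscribed K x.1 x.2}.Nonempty := by
    have hu : (1, 0) ≠ (0 : ℝ × ℝ) := by simp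
    have hg := hK.gauge_pos hu
    obtain ⟨q, hq, -⟩ := hK.exists_isInscribed (u := (gauge K (1, 0))⁻¹ • (1, 0)) (w := (0, 1))
      (by rw [hK.gauge_smul, abs_of_pos (inv_pos.2 hg), inv_mul_cancel₀ hg.ne'])
      (by rw [wedge_smul_left]; simpa [wedge] using hg)
    exact ⟨(_, q), hq⟩
  obtain ⟨x, hx, he⟩ := hK.isCompact_isInscribed.exists_sInf_image_eq hne
    (f := fun x : (ℝ × ℝ) × (ℝ × ℝ) => |wedge x.1 x.2|) (by fun_prop)
  exact ⟨x.1, x.2, hx, he.symm⟩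

lemma inscribedDet_pos (hK : IsCSCD K) : 0 < inscribedDet K := by
  obtain ⟨p, q, h, he⟩ := hK.exists_inscribedDet
  rw [← he]
  exact abs_pos.2 (hK.wedge_ne_zero_of_isInscribed h)

lemma inscribedDet_le (hK : IsCSCD K) {v w : ℝ × ℝ} (h : wedge v w ≠ 0)
    (hA : IsAdmissible K v w) : inscribedDet K ≤ |wedge v w| := by
  obtain ⟨u, q, h1, h2⟩ := hK.exists_isInscribed_abs_wedge_le h hA
  exact (inscribedDet_le_of_isInscribed h1).trans h2

lemma interior_translate (p : ℝ × ℝ) :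
    interior ((fun x => p + x) '' K) = (fun x => p + x) '' interior K :=
  ((Homeomorph.addLeft p).image_interior K).symm

lemma isPacking_iff (hK : IsCSCD K) {v w : ℝ × ℝ} (h : wedge v w ≠ 0) :
    IsPacking K (latticeOf v w) ↔ IsAdmissible K ((1 / 2 : ℝ) • v) ((1 / 2 : ℝ) • w) := by
  have hhalf : ∀ a b : ℝ, a • ((1 / 2 : ℝ) • v) + b • ((1 / 2 : ℝ) • w) =
      (1 / 2 : ℝ) • (a • v + b • w) := fun a b => by module
  constructor
  · intro hp m n hmn
    by_contra! hlt
    rw [hhalf] at hlt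
    set y := (m : ℝ) • v + (n : ℝ) • w with hy
    have hy0 : y ≠ 0 := by
      intro h0
      have e1 : wedge y w = m * wedge v w := by
        rw [hy, wedge_add_left, wedge_smul_left, wedge_smul_left, wedge_self]; ring
      have e2 : wedge v y = n * wedge v w := by
        rw [hy, wedge_add_right, wedge_smul_right, wedge_smul_right, wedge_self]; ring
      have : wedge v 0 = 0 := by simp [wedge]
      rw [h0, wedge_zero_left] at e1
      rw [h0, this] at e2
      rcases hmn with hm | hn
      · rcases mul_eq_zero.1 e1.symm with h' | h'
        · exact hm (by exact_mod_cast h')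
        · exact h h'
      · rcases mul_eq_zero.1 e2.symm with h' | h'
        · exact hn (by exact_mod_cast h')
        · exact h h'
    have hemp := hp y ⟨m, n, rfl⟩ 0 ⟨0, 0, by simp⟩ hy0
    rw [interior_translate, interior_translate] at hemp
    have hmem : (1 / 2 : ℝ) • y ∈ ((fun x => y + x) '' interior K) ∩
        ((fun x => 0 + x) '' interior K) := by
      refine ⟨⟨-((1 / 2 : ℝ) • y), ?_, by module⟩, ⟨(1 / 2 : ℝ) • y, ?_, by simp⟩⟩
      · rw [← hK.gauge_lt_one_iff, hK.gauge_neg]; exact hlt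
      · exact hK.gauge_lt_one_iff.1 hlt
    rw [hemp] at hmem
    exact hmem
  · rintro hA p ⟨m, n, rfl⟩ q ⟨m', n', rfl⟩ hne
    rw [interior_translate, interior_translate, eq_empty_iff_forall_notMem]
    rintro _ ⟨⟨a, ha, rfl⟩, ⟨b, hb, hab⟩⟩
    have hmn : m - m' ≠ 0 ∨ n - n' ≠ 0 := by
      by_contra! hc
      rw [sub_eq_zero, sub_eq_zero] at hc
      exact hne (by rw [hc.1, hc.2])
    have hk := hA _ _ hmn
    rw [hhalf] at hk
    rw [← hK.gauge_lt_one_iff] at ha hb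
    have he : ((m - m' : ℤ) : ℝ) • v + ((n - n' : ℤ) : ℝ) • w = b - a := by
      simp only at hab
      rw [eq_sub_iff_add_eq, ← add_right_inj ((m' : ℝ) • v + (n' : ℝ) • w), hab]
      push_cast; module
    rw [he, hK.gauge_smul] at hk
    have := hK.gauge_sub_le b a
    rw [abs_of_pos (by norm_num)] at hk
    linarith

lemma deltaLat_eq (hK : IsCSCD K) :
    deltaLat K = (volume K).toReal / (4 * inscribedDet K) := by
  have hd := hK.inscribedDet_pos
  have hub : ∀ d ∈ packingDensities K, d ≤ (volume K).toReal / (4 * inscribedDet K) := by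
    rintro d ⟨v, w, h, hp, rfl⟩
    rw [hK.isPacking_iff h] at hp
    have := hK.inscribedDet_le (by
      rw [wedge_smul_left, wedge_smul_right]
      simpa using h) hp
    rw [wedge_smul_left, wedge_smul_right, abs_mul, abs_mul, abs_of_pos (by norm_num)] at this
    exact div_le_div_of_nonneg_left ENNReal.toReal_nonneg (by positivity) (by linarith)
  obtain ⟨p, q, h, he⟩ := hK.exists_inscribedDet
  have hmem : (volume K).toReal / (4 * inscribedDet K) ∈ packingDensities K := by
    have hw := hK.wedge_ne_zero_of_isInscribed h
    have hw2 : wedge ((2 : ℝ) • p) ((2 : ℝ) • q) ≠ 0 := by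
      rw [wedge_smul_left, wedge_smul_right]; simpa using hw
    refine ⟨(2 : ℝ) • p, (2 : ℝ) • q, hw2, ?_, ?_⟩
    · rw [hK.isPacking_iff hw2, smul_smul, smul_smul]
      norm_num
      exact hK.isAdmissible_of_isInscribed h
    · rw [wedge_smul_left, wedge_smul_right, ← mul_assoc, abs_mul, he]
      norm_num
  exact le_antisymm (csSup_le ⟨_, hmem⟩ hub) (le_csSup ⟨_, hub⟩ hmem)

end IsCSCD

lemma IsCompact.convexJoin {s t : Set (ℝ × ℝ)} (hs : IsCompact s) (ht : IsCompact t) :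
    IsCompact (convexJoin ℝ s t) := by
  have : _root_.convexJoin ℝ s t =
      (fun x : (ℝ × ℝ) × (ℝ × ℝ) × ℝ => x.1 + x.2.2 • (x.2.1 - x.1)) ''
        (s ×ˢ (t ×ˢ Icc (0 : ℝ) 1)) := by
    ext x
    simp only [mem_convexJoin, segment_eq_image', mem_image]
    constructor
    · rintro ⟨a, ha, b, hb, θ, hθ, rfl⟩
      exact ⟨(a, b, θ), ⟨ha, hb, hθ⟩, rfl⟩
    · rintro ⟨⟨a, b, θ⟩, ⟨ha, hb, hθ⟩, rfl⟩
      exact ⟨a, ha, b, hb, θ, hθ, rfl⟩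
  rw [this]
  exact (hs.prod (ht.prod isCompact_Icc)).image (by fun_prop)

/-- A compact subset of a convex set missing an extreme point lies in a compact convex subset
missing that point. -/
lemma exists_convex_compact_superset {K S : Set (ℝ × ℝ)} (hconv : Convex ℝ K) (hcomp : IsCompact K)
    {p : ℝ × ℝ} (hp : p ∈ K.extremePoints ℝ) (hS : IsCompact S) (hSK : S ⊆ K) (hpS : p ∉ S) :
    ∃ C, IsCompact C ∧ Convex ℝ C ∧ S ⊆ C ∧ C ⊆ K ∧ p ∉ C := by
  have hKp : Convex ℝ (K \ {p}) := (hconv.mem_extremePoints_iff_convex_sdiff.1 hp).2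
  suffices h : ∃ C, IsCompact C ∧ Convex ℝ C ∧ S ⊆ C ∧ C ⊆ K \ {p} by
    obtain ⟨C, h1, h2, h3, h4⟩ := h
    exact ⟨C, h1, h2, h3, fun x hx => (h4 hx).1, fun hx => (h4 hx).2 rfl⟩
  refine hS.induction_on (p := fun A => ∃ C, IsCompact C ∧ Convex ℝ C ∧ A ⊆ C ∧ C ⊆ K \ {p})
    ⟨∅, isCompact_empty, convex_empty, subset_rfl, empty_subset _⟩ ?_ ?_ ?_
  · rintro A B hAB ⟨C, h1, h2, h3, h4⟩
    exact ⟨C, h1, h2, hAB.trans h3, h4⟩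
  · rintro A B ⟨C, h1, h2, h3, h4⟩ ⟨D, k1, k2, k3, k4⟩
    rcases C.eq_empty_or_nonempty with rfl | hC
    · exact ⟨D, k1, k2, union_subset (h3.trans (empty_subset _)) k3, k4⟩
    rcases D.eq_empty_or_nonempty with rfl | hD
    · exact ⟨C, h1, h2, union_subset h3 (k3.trans (empty_subset _)), h4⟩
    exact ⟨convexJoin ℝ C D, h1.convexJoin k1, h2.convexJoin k2,
      union_subset (h3.trans (subset_convexJoin_left hD)) (k3.trans (subset_convexJoin_right hC)),
      convexJoin_subset h4 k4 hKp⟩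
  · intro x hx
    have hxp : x ≠ p := fun h => hpS (h ▸ hx)
    have hd : 0 < dist x p := dist_pos.2 hxp
    refine ⟨K ∩ Metric.closedBall x (dist x p / 2), inter_mem
      (mem_of_superset self_mem_nhdsWithin hSK)
      (nhdsWithin_le_nhds (Metric.closedBall_mem_nhds x (by positivity))), _,
      hcomp.inter (isCompact_closedBall _ _), hconv.inter (convex_closedBall _ _), subset_rfl, ?_⟩
    rintro y ⟨hy, hyb⟩
    refine ⟨hy, ?_⟩
    rintro rfl
    rw [Metric.mem_closedBall, dist_comm] at hyb
    linarith

namespace IsCSCD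

variable {K : Set (ℝ × ℝ)}

lemma gauge_eq_one_of_mem_extremePoints (hK : IsCSCD K) {p : ℝ × ℝ}
    (hp : p ∈ K.extremePoints ℝ) : gauge K p = 1 := by
  refine le_antisymm (hK.gauge_le_one_iff.2 hp.1) ?_
  by_contra! hlt
  have hcont : Continuous fun t : ℝ => gauge K (p + t • ((1, 0) : ℝ × ℝ)) :=
    hK.continuous_gauge.comp (by fun_prop)
  have h0 : ∀ᶠ t in 𝓝 (0 : ℝ), gauge K (p + t • ((1, 0) : ℝ × ℝ)) < 1 :=
    hcont.continuousAt.eventually_lt continuousAt_const (by simpa using hlt)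
  obtain ⟨ε, hε, hb⟩ := Metric.eventually_nhds_iff.1 h0
  have h1 := hb (y := ε / 2) (by rw [dist_zero_right, Real.norm_eq_abs, abs_of_pos] <;> linarith)
  have h2 := hb (y := -(ε / 2)) (by
    rw [dist_zero_right, Real.norm_eq_abs, abs_neg, abs_of_pos] <;> linarith)
  have := (mem_extremePoints.1 hp).2 _ (hK.gauge_le_one_iff.1 h1.le) _
    (hK.gauge_le_one_iff.1 h2.le) ⟨1 / 2, 1 / 2, by norm_num, by norm_num, by norm_num, by module⟩
  have h3 := congrArg Prod.fst this.1
  simp at h3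
  linarith

end IsCSCD

/-- Cutting a miserly domain near an extreme point produces an inscribed pair of small covolume
near that point. -/
lemma IsMiserly.exists_near {K : Set (ℝ × ℝ)} (hK : IsMiserly K) {p : ℝ × ℝ}
    (hp : p ∈ K.extremePoints ℝ) {ε : ℝ} (hε : 0 < ε) (hεp : ε < ‖p‖) :
    ∃ u q : ℝ × ℝ, dist u p ≤ ε ∧ q ∈ K ∧
      (∀ z, z = q ∨ z = u + q → min |gauge K z - 1| (min (dist z p) (dist z (-p))) ≤ ε) ∧
      |wedge u q| ≤ inscribedDet K := by
  have hC := hK.1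
  set S := K \ (Metric.ball p ε ∪ Metric.ball (-p) ε) with hS
  have hScomp : IsCompact S := hC.2.1.diff (Metric.isOpen_ball.union Metric.isOpen_ball)
  have hneg : ∀ x, dist (-x) (-p) = dist x p := fun x => dist_neg_neg x p
  have hneg' : ∀ x, dist (-x) p = dist x (-p) := fun x => by rw [← dist_neg_neg, neg_neg]
  have hSneg : ∀ x ∈ S, -x ∈ S := by
    rintro x ⟨hx, hx'⟩
    refine ⟨hC.neg_mem hx, ?_⟩
    simp only [mem_union, Metric.mem_ball, hneg, hneg'] at hx' ⊢
    tauto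
  obtain ⟨C, C1, C2, C3, C4, C5⟩ := exists_convex_compact_superset hC.1 hC.2.1 hp hScomp
    sdiff_subset (fun h => h.2 (Or.inl (Metric.mem_ball_self hε)))
  set K' := C ∩ -C with hK'
  have hSK' : S ⊆ K' := fun x hx => ⟨C3 hx, C3 (hSneg x hx)⟩
  have hK'K : K' ⊆ K := fun x hx => C4 hx.1
  have hnhds : K' ∈ 𝓝 (0 : ℝ × ℝ) := by
    refine mem_of_superset ?_ hSK'
    refine inter_mem hC.mem_nhds ?_
    have h1 : ∀ z : ℝ × ℝ, ‖z‖ = ‖p‖ → (Metric.closedBall z ε)ᶜ ∈ 𝓝 (0 : ℝ × ℝ) := fun z hz =>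
      Metric.isClosed_closedBall.isOpen_compl.mem_nhds (by simp [hz, hεp])
    filter_upwards [h1 p rfl, h1 (-p) (norm_neg p)] with x hx hx'
    rintro (h | h)
    · exact hx (Metric.ball_subset_closedBall h)
    · exact hx' (Metric.ball_subset_closedBall h)
  have hC' : IsCSCD K' := by
    refine ⟨C2.inter C2.neg, C1.inter C1.neg, ⟨0, mem_interior_iff_mem_nhds.2 hnhds⟩, ?_⟩
    ext x
    simp [hK', and_comm]
  have hvol : (volume K').toReal < (volume K).toReal := by
    have hU : (interior K ∩ K'ᶜ).Nonempty := by
      have h1 : p ∈ closure (interior K) := by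
        rw [hC.1.closure_interior_eq_closure_of_nonempty_interior hC.2.2.1]
        exact subset_closure hp.1
      have h2 : K'ᶜ ∈ 𝓝 p := hC'.2.1.isClosed.isOpen_compl.mem_nhds fun h => C5 h.1
      obtain ⟨x, hx, hx'⟩ := mem_closure_iff_nhds.1 h1 _ h2
      exact ⟨x, hx', hx⟩
    have hUpos : 0 < volume (interior K ∩ K'ᶜ) :=
      (isOpen_interior.inter hC'.2.1.isClosed.isOpen_compl).measure_pos volume hU
    have hpos : 0 < volume (K \ K') :=
      hUpos.trans_le (measure_mono fun x hx => ⟨interior_subset hx.1, hx.2⟩)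
    have hadd := measure_sdiff_add_inter (μ := volume) K hC'.2.1.isClosed.measurableSet
    rw [inter_eq_self_of_subset_right hK'K] at hadd
    have hfin : volume K' ≠ ⊤ := hC'.2.1.measure_lt_top.ne
    refine (ENNReal.toReal_lt_toReal hfin hC.2.1.measure_lt_top.ne).2 ?_
    rw [← hadd, add_comm]
    exact ENNReal.lt_add_right hfin hpos.ne'
  have hdet : inscribedDet K' < inscribedDet K := by
    have h := hK.2 K' hC'
    rw [hC.deltaLat_eq, hC'.deltaLat_eq] at h
    have d1 := hC.inscribedDet_pos
    have d2 := hC'.inscribedDet_pos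
    rw [div_le_div_iff₀ (by positivity) (by positivity)] at h
    have hv : 0 ≤ (volume K').toReal := ENNReal.toReal_nonneg
    by_contra! hle
    nlinarith
  obtain ⟨u, q, ⟨g1, g2, g3⟩, hw⟩ := hC'.exists_inscribedDet
  have hle : |wedge u q| ≤ inscribedDet K := hw.trans_le hdet.le
  have hnear : ∀ z, gauge K' z = 1 → z ∈ K ∧
      (gauge K z = 1 ∨ dist z p ≤ ε ∨ dist z (-p) ≤ ε) := by
    intro z hz
    have hzK : z ∈ K := hK'K (hC'.gauge_le_one_iff.1 hz.le)
    refine ⟨hzK, ?_⟩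
    by_contra! hcon
    have hzi : z ∈ interior K :=
      hC.gauge_lt_one_iff.1 (lt_of_le_of_ne (hC.gauge_le_one_iff.2 hzK) hcon.1)
    have hzi' : z ∈ interior K' := by
      refine mem_interior.2 ⟨interior K ∩ ((Metric.closedBall p ε)ᶜ ∩ (Metric.closedBall (-p) ε)ᶜ),
        ?_, isOpen_interior.inter (Metric.isClosed_closedBall.isOpen_compl.inter
          Metric.isClosed_closedBall.isOpen_compl), hzi, ?_, ?_⟩
      · rintro x ⟨hx, hx1, hx2⟩
        refine hSK' ⟨interior_subset hx, ?_⟩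
        rintro (h | h)
        · exact hx1 (Metric.ball_subset_closedBall h)
        · exact hx2 (Metric.ball_subset_closedBall h)
      · simpa using hcon.2.1
      · simpa using hcon.2.2
    exact (hC'.gauge_lt_one_iff.2 hzi').ne hz
  have hphi : ∀ z, gauge K' z = 1 →
      min |gauge K z - 1| (min (dist z p) (dist z (-p))) ≤ ε := by
    intro z hz
    rcases (hnear z hz).2 with h | h | h
    · rw [h]; simp [hε.le]
    · exact (min_le_right _ _).trans ((min_le_left _ _).trans h)
    · exact (min_le_right _ _).trans ((min_le_right _ _).trans h)
  have hfinish : ∀ u q : ℝ × ℝ, gauge K' q = 1 → gauge K' (u + q) = 1 →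
      |wedge u q| ≤ inscribedDet K → (dist u p ≤ ε ∨ dist u (-p) ≤ ε) →
      ∃ u q : ℝ × ℝ, dist u p ≤ ε ∧ q ∈ K ∧
      (∀ z, z = q ∨ z = u + q → min |gauge K z - 1| (min (dist z p) (dist z (-p))) ≤ ε) ∧
      |wedge u q| ≤ inscribedDet K := by
    intro u q h2 h3 hw h
    rcases h with h | h
    · refine ⟨u, q, h, (hnear q h2).1, ?_, hw⟩
      rintro z (rfl | rfl)
      exacts [hphi _ h2, hphi _ h3]
    · have h2' : gauge K' (-q) = 1 := by rw [hC'.gauge_neg, h2]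
      have h3' : gauge K' (-u + -q) = 1 := by rw [← neg_add, hC'.gauge_neg, h3]
      refine ⟨-u, -q, by rw [hneg']; exact h, (hnear _ h2').1, ?_, ?_⟩
      · rintro z (rfl | rfl)
        exacts [hphi _ h2', hphi _ h3']
      · rwa [wedge_neg_left, wedge_neg_right, neg_neg]
  by_cases hu : dist u p ≤ ε ∨ dist u (-p) ≤ ε
  · exact hfinish u q g2 g3 hle hu
  by_cases hq : dist q p ≤ ε ∨ dist q (-p) ≤ ε
  · exact hfinish q u g1 (by rw [add_comm]; exact g3)
      (by rw [wedge_comm_neg, abs_neg]; exact hle) hq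
  by_cases huq : dist (u + q) p ≤ ε ∨ dist (u + q) (-p) ≤ ε
  · refine hfinish (u + q) (-q) (by rw [hC'.gauge_neg, g2]) (by rw [add_neg_cancel_right, g1])
      ?_ huq
    rwa [wedge_neg_right, wedge_add_left, wedge_self, add_zero, abs_neg]
  · have : IsInscribed K u q :=
      ⟨(hnear u g1).2.resolve_right hu, (hnear q g2).2.resolve_right hq,
        (hnear _ g3).2.resolve_right huq⟩
    have := IsCSCD.inscribedDet_le_of_isInscribed this
    linarith

/-- Every extreme point of a miserly domain belongs to an inscribed pair of minimal covolume. -/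
lemma IsMiserly.exists_critical {K : Set (ℝ × ℝ)} (hK : IsMiserly K) {p : ℝ × ℝ}
    (hp : p ∈ K.extremePoints ℝ) : ∃ q, IsInscribed K p q ∧ |wedge p q| = inscribedDet K := by
  have hC := hK.1
  have hgp := hC.gauge_eq_one_of_mem_extremePoints hp
  have hp0 : 0 < ‖p‖ := norm_pos_iff.2 (by rintro rfl; simp at hgp)
  have hex := fun n : ℕ => hK.exists_near hp (ε := ‖p‖ / (n + 2)) (by positivity)
    (by rw [div_lt_iff₀ (by positivity)]; nlinarith [Nat.cast_nonneg (α := ℝ) n])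
  choose u q h1 h2 h3 h4 using hex
  have hεlim : Tendsto (fun n : ℕ => ‖p‖ / ((n : ℝ) + 2)) atTop (𝓝 0) :=
    tendsto_const_nhds.div_atTop
      (tendsto_atTop_add_const_right _ _ tendsto_natCast_atTop_atTop)
  have hu : Tendsto u atTop (𝓝 p) := tendsto_iff_dist_tendsto_zero.2
    (squeeze_zero (fun _ => dist_nonneg) h1 hεlim)
  obtain ⟨q₀, hq₀, φ, hφ, hlim⟩ := hC.2.1.tendsto_subseq h2
  have hu' := hu.comp hφ.tendsto_atTop
  have hε' := hεlim.comp hφ.tendsto_atTop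
  have hcont : Continuous fun z => min |gauge K z - 1| (min (dist z p) (dist z (-p))) := by
    have := hC.continuous_gauge
    fun_prop
  have hone : ∀ z, min |gauge K z - 1| (min (dist z p) (dist z (-p))) ≤ 0 → gauge K z = 1 := by
    intro z hz
    rcases min_le_iff.1 hz with h | h
    · exact sub_eq_zero.1 (abs_eq_zero.1 (le_antisymm h (abs_nonneg _)))
    · rcases min_le_iff.1 h with h | h
      · rw [dist_le_zero.1 h, hgp]
      · rw [dist_le_zero.1 h, hC.gauge_neg, hgp]
  have hins : IsInscribed K p q₀ := by
    refine ⟨hgp, hone _ ?_, hone _ ?_⟩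
    · exact le_of_tendsto_of_tendsto' ((hcont.tendsto _).comp hlim) hε'
        fun n => h3 _ _ (Or.inl rfl)
    · exact le_of_tendsto_of_tendsto' ((hcont.tendsto _).comp (hu'.add hlim)) hε'
        fun n => h3 _ _ (Or.inr rfl)
  refine ⟨q₀, hins, le_antisymm ?_ (IsCSCD.inscribedDet_le_of_isInscribed hins)⟩
  have hw : Continuous fun x : (ℝ × ℝ) × (ℝ × ℝ) => |wedge x.1 x.2| := by fun_prop
  exact le_of_tendsto' ((hw.tendsto (p, q₀)).comp (hu'.prodMk_nhds hlim)) fun n => h4 _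

/-- An inscribed pair of minimal covolume. -/
def IsCritical (K : Set (ℝ × ℝ)) (p q : ℝ × ℝ) : Prop :=
  IsInscribed K p q ∧ |wedge p q| = inscribedDet K

/-- Every boundary point of `K` has a unique supporting line. -/
def HasUniqueSupport (K : Set (ℝ × ℝ)) : Prop :=
  ∀ p l l', gauge K p = 1 → l ∈ wedgePolar K → l' ∈ wedgePolar K → wedge p l = 1 →
    wedge p l' = 1 → l = l'

namespace IsCritical

variable {K : Set (ℝ × ℝ)} {p q : ℝ × ℝ}

lemma symm (h : IsCritical K p q) : IsCritical K q p :=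
  ⟨h.1.symm, by rw [wedge_comm_neg, abs_neg]; exact h.2⟩

lemma rotate (hK : IsCSCD K) (h : IsCritical K p q) : IsCritical K q (-(p + q)) := by
  refine ⟨h.1.rotate hK, ?_⟩
  rw [wedge_neg_right, wedge_add_right, wedge_self, add_zero, wedge_comm_neg q p, neg_neg]
  exact h.2

/-- Minimal inscribed hexagons are not inscribed in circumscribed parallelograms. -/
lemma wedge_neg_of_mem_wedgePolar (hK : IsCSCD K) (hU : HasUniqueSupport K)
    (h : IsCritical K p q) {l : ℝ × ℝ} (hl : l ∈ wedgePolar K) (hpl : wedge p l = 1) :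
    wedge q l < 0 := by
  obtain ⟨⟨hp, hq, hpq⟩, hD⟩ := h
  have hle := hK.wedge_le_gauge hl (p + q)
  rw [wedge_add_left, hpl, hpq] at hle
  refine lt_of_le_of_ne (by linarith) fun hql => ?_
  obtain ⟨l₂, hl₂, hql₂⟩ := hK.exists_mem_wedgePolar hq.ge
  obtain ⟨z, hzK, hz⟩ := hK.2.1.exists_isMaxOn (hK.2.2.1.mono interior_subset)
    (f := fun z => wedge z (l + l₂)) (by fun_prop)
  have hmax : ∀ y ∈ K, wedge y (l + l₂) ≤ wedge z (l + l₂) := fun y hy => hz hy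
  obtain ⟨ε, hε⟩ : ∃ ε, wedge z (l + l₂) = 2 - ε := ⟨2 - wedge z (l + l₂), by ring⟩
  have hε1 : ε ≤ 1 := by
    have := hmax q (hK.gauge_le_one_iff.1 hq.le)
    rw [wedge_add_right, hql, hql₂] at this
    linarith
  have hε0 : 0 < ε := by
    have h1 := hl z hzK
    have h2 := hl₂ z hzK
    rw [wedge_add_right] at hε
    by_contra! hε0
    have e1 : wedge z l = 1 := by linarith
    have e2 : wedge z l₂ = 1 := by linarith
    have hgz : gauge K z = 1 :=
      le_antisymm (hK.gauge_le_one_iff.2 hzK) (e1 ▸ hK.wedge_le_gauge hl z)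
    have := hU z l l₂ hgz hl hl₂ e1 e2
    rw [this] at hql
    linarith
  set y₀ := wedge p l₂ with hy₀
  set e : ℝ × ℝ := p - y₀ • q with he
  have heX : wedge e l = 1 := by
    rw [he, wedge_sub_left, wedge_smul_left, hpl, hql]; ring
  have heY : wedge e l₂ = 0 := by
    rw [he, wedge_sub_left, wedge_smul_left, hql₂, ← hy₀]; ring
  have heq : wedge e q = wedge p q := by
    rw [he, wedge_sub_left, wedge_smul_left, wedge_self]; ring
  have hmem : (2 - ε)⁻¹ • (l + l₂) ∈ wedgePolar K := by
    intro y hy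
    rw [wedge_smul_right, inv_mul_le_iff₀ (by linarith), mul_one, ← hε]
    exact hmax y hy
  have hd : (2 - ε) ≠ 0 := by linarith
  have hv : wedge (e - (ε / 2) • q) ((2 - ε)⁻¹ • (l + l₂)) = 1 / 2 := by
    simp only [wedge_sub_left, wedge_smul_left, wedge_smul_right, wedge_add_right, heX, heY, hql,
      hql₂]
    field_simp
    ring
  have hw : wedge (q - (ε / 2) • e) ((2 - ε)⁻¹ • (l + l₂)) = 1 / 2 := by
    simp only [wedge_sub_left, wedge_smul_left, wedge_smul_right, wedge_add_right, heX, heY, hql,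
      hql₂]
    field_simp
    ring
  have hA : IsAdmissible K (e - (ε / 2) • q) (q - (ε / 2) • e) := by
    refine hK.isAdmissible_of_polar hl hl₂ hmem ?_ ?_ ?_ ?_ ?_ ?_
    · rw [wedge_sub_left, wedge_smul_left, heX, hql]; linarith
    · rw [wedge_sub_left, wedge_smul_left, heX, hql]; linarith
    · rw [wedge_sub_left, wedge_smul_left, heY, hql₂]; linarith
    · rw [hv]; norm_num
    · rw [hw]; norm_num
    · rw [wedge_add_left, hv, hw]; norm_num
  have hdet : wedge (e - (ε / 2) • q) (q - (ε / 2) • e) = (1 - ε ^ 2 / 4) * wedge p q := by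
    rw [← heq]
    simp only [wedge_sub_left, wedge_sub_right, wedge_smul_left, wedge_smul_right, wedge_self,
      wedge_comm_neg q e]
    ring
  have hpos : 0 < 1 - ε ^ 2 / 4 := by nlinarith
  have hDpos := hK.inscribedDet_pos
  have hne : wedge p q ≠ 0 := by
    intro h0; rw [h0, abs_zero] at hD; linarith
  have := hK.inscribedDet_le (by rw [hdet]; exact mul_ne_zero hpos.ne' hne) hA
  rw [hdet, abs_mul, abs_of_pos hpos, hD] at this
  nlinarith [mul_pos (pow_pos hε0 2) hDpos]

end IsCritical

namespace IsCSCD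

variable {K : Set (ℝ × ℝ)}

lemma exists_wedge_le_neg (hK : IsCSCD K) (hU : HasUniqueSupport K) :
    ∃ κ : ℝ, 0 < κ ∧ ∀ p q l, IsCritical K p q → l ∈ wedgePolar K → wedge p l = 1 →
      wedge q l ≤ -κ := by
  set S : Set (((ℝ × ℝ) × (ℝ × ℝ)) × (ℝ × ℝ)) :=
    ({x | IsInscribed K x.1 x.2} ×ˢ wedgePolar K) ∩
      ({x | |wedge x.1.1 x.1.2| = inscribedDet K} ∩ {x | wedge x.1.1 x.2 = 1}) with hS
  have hSc : IsCompact S := (hK.isCompact_isInscribed.prod hK.isCompact_wedgePolar).inter_right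
    ((isClosed_eq (by fun_prop) (by fun_prop)).inter (isClosed_eq (by fun_prop) (by fun_prop)))
  rcases S.eq_empty_or_nonempty with hE | hE
  · refine ⟨1, one_pos, fun p q l h hl hpl => ?_⟩
    have : ((p, q), l) ∈ S := ⟨⟨h.1, hl⟩, h.2, hpl⟩
    rw [hE] at this
    exact this.elim
  · obtain ⟨⟨⟨p, q⟩, l⟩, hmem, hmax⟩ := hSc.exists_isMaxOn hE
      (f := fun x => wedge x.1.2 x.2) (by fun_prop)
    refine ⟨-wedge q l, ?_, fun p' q' l' h hl hpl => ?_⟩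
    · have := IsCritical.wedge_neg_of_mem_wedgePolar hK hU ⟨hmem.1.1, hmem.2.1⟩ hmem.1.2 hmem.2.2
      linarith
    · rw [neg_neg]
      exact hmax (show ((p', q'), l') ∈ S from ⟨⟨h.1, hl⟩, h.2, hpl⟩)

lemma neg_mem_wedgePolar (hK : IsCSCD K) {l : ℝ × ℝ} (hl : l ∈ wedgePolar K) :
    -l ∈ wedgePolar K := by
  intro y hy
  rw [wedge_neg_right, ← wedge_neg_left]
  exact hl _ (hK.neg_mem hy)

set_option maxHeartbeats 1000000 in
lemma eventually_neg_le_wedge_of_pos (hK : IsCSCD K) {κ R L : ℝ} (hκ : 0 < κ) (hR : 0 < R)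
    (hL : 0 < L) (hRK : ∀ x ∈ K, ‖x‖ ≤ R) (hLK : ∀ l ∈ wedgePolar K, ‖l‖ ≤ L)
    (hκK : ∀ p q l, IsCritical K p q → l ∈ wedgePolar K → wedge p l = 1 → wedge q l ≤ -κ)
    {p q l : ℝ × ℝ} (hcrit : IsCritical K p q) (hpos : 0 < wedge p q) (hl : l ∈ wedgePolar K)
    (hpl : wedge p l = 1) :
    ∀ᶠ v in 𝓝 (0 : ℝ × ℝ), 1 ≤ gauge K (p + v) →
      -(4 * R * L / κ / (κ ^ 2 * inscribedDet K)) * ‖v‖ ^ 2 ≤ wedge v l := by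
  set D := inscribedDet K with hD
  set A := 4 * R * L / κ with hA
  have hDpos : 0 < D := hK.inscribedDet_pos
  have hApos : 0 < A := by positivity
  have hpq : wedge p q = D := by rw [hD, ← hcrit.2, abs_of_pos hpos]
  have hc2 : IsCritical K q (-(p + q)) := hcrit.rotate hK
  have hc4 : IsCritical K (-(p + q)) p := by
    have := hc2.rotate hK
    rwa [show -(q + -(p + q)) = p by module] at this
  set p₄ := -(p + q) with hp₄
  obtain ⟨l₂, hl₂, e₂⟩ := hK.exists_mem_wedgePolar hc2.1.1.ge
  obtain ⟨l₄, hl₄, e₄⟩ := hK.exists_mem_wedgePolar hc4.1.1.ge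
  obtain ⟨α, hα⟩ : ∃ α, wedge p₄ l₂ = -α := ⟨_, (neg_neg _).symm⟩
  obtain ⟨β, hβ⟩ : ∃ β, wedge q l₄ = -β := ⟨_, (neg_neg _).symm⟩
  have hp2 : wedge p l₂ = α - 1 := by
    rw [hp₄, wedge_neg_left, wedge_add_left, e₂] at hα; linarith
  have hp4 : wedge p l₄ = β - 1 := by
    rw [hp₄, wedge_neg_left, wedge_add_left, hβ] at e₄; linarith
  have a1 : κ ≤ α := by
    have := hκK _ _ _ hc2 hl₂ e₂; rw [hα] at this; linarith
  have a2 : α ≤ 1 - κ := by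
    have := hκK _ _ _ hcrit.symm hl₂ e₂; rw [hp2] at this; linarith
  have b1 : κ ≤ β := by
    have := hκK _ _ _ hc2.symm hl₄ e₄; rw [hβ] at this; linarith
  have b2 : β ≤ 1 - κ := by
    have := hκK _ _ _ hc4 hl₄ e₄; rw [hp4] at this; linarith
  have hαβ : κ ≤ 1 - α * β := by nlinarith
  have hαβ0 : 0 < 1 - α * β := by linarith
  have hαβ1 : 1 - α * β ≤ 1 := by nlinarith
  set u := p₄ + α • q with hu
  have hu2 : wedge u l₂ = 0 := by
    rw [hu, wedge_add_left, wedge_smul_left, hα, e₂]; ring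
  have hu4 : wedge u l₄ = 1 - α * β := by
    rw [hu, wedge_add_left, wedge_smul_left, hβ, e₄]; ring
  have hpu : wedge p u = -((1 - α) * D) := by
    rw [hu, hp₄, wedge_add_right, wedge_neg_right, wedge_add_right, wedge_smul_right, wedge_self,
      hpq]
    ring
  have hnu : ‖u‖ ≤ 2 * R := by
    have h1 := hRK _ (hK.gauge_le_one_iff.1 hc4.1.1.le)
    have h2 := hRK _ (hK.gauge_le_one_iff.1 hc2.1.1.le)
    calc ‖u‖ ≤ ‖p₄‖ + ‖α • q‖ := norm_add_le _ _
      _ ≤ R + 1 * R := by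
        rw [norm_smul, Real.norm_eq_abs, abs_of_nonneg (by linarith : 0 ≤ α)]
        gcongr
        linarith
      _ = 2 * R := by ring
  set w : ℝ × ℝ → ℝ × ℝ := fun v => (-(wedge v l₄) / (1 - α * β)) • u with hw
  have hwc : Continuous w := by fun_prop
  have hw0 : w 0 = 0 := by simp [hw, wedge_zero_left]
  have hw2 : ∀ v, wedge (w v) l₂ = 0 := fun v => by rw [hw, wedge_smul_left, hu2, mul_zero]
  have hw4 : ∀ v, wedge v l₄ + wedge (w v) l₄ = 0 := fun v => by
    rw [hw, wedge_smul_left, hu4]; field_simp; ring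
  have hnw : ∀ v, ‖w v‖ ≤ A * ‖v‖ := fun v => by
    have h1 : |wedge v l₄| ≤ 2 * ‖v‖ * L :=
      (abs_wedge_le _ _).trans (by gcongr; exact hLK _ hl₄)
    rw [hw, norm_smul, Real.norm_eq_abs, abs_div, abs_neg, abs_of_pos hαβ0]
    calc |wedge v l₄| / (1 - α * β) * ‖u‖ ≤ 2 * ‖v‖ * L / κ * (2 * R) := by gcongr
      _ = A * ‖v‖ := by rw [hA]; ring
  set c := (1 - α) * D / (1 - α * β) with hc
  set m := q + c • l₄ with hm
  have hF : ∀ v, wedge (p + v) (q + w v) = D + wedge v m + wedge v (w v) := fun v => by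
    have : wedge p (w v) = wedge v l₄ * c := by
      rw [hw, wedge_smul_right, hpu, hc]; ring
    have hvm : wedge v m = wedge v q + c * wedge v l₄ := by
      rw [hm, wedge_add_right, wedge_smul_right]
    rw [wedge_add_left, wedge_add_right, wedge_add_right, this, hvm, hpq]
    ring
  set f := wedge p m with hf
  have hfD : 2 * κ ^ 2 * D ≤ f := by
    have : f = D * (α * (1 - β) + β * (1 - α)) / (1 - α * β) := by
      rw [hf, hm, wedge_add_right, wedge_smul_right, hp4, hpq, hc]
      field_simp
      ring
    rw [this, le_div_iff₀ hαβ0]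
    have h1 : κ * κ ≤ α * (1 - β) := mul_le_mul a1 (by linarith) hκ.le (by linarith)
    have h2 : κ * κ ≤ β * (1 - α) := mul_le_mul b1 (by linarith) hκ.le (by linarith)
    calc 2 * κ ^ 2 * D * (1 - α * β) ≤ 2 * κ ^ 2 * D * 1 := by gcongr
      _ = D * (κ * κ + κ * κ) := by ring
      _ ≤ _ := by gcongr
  have hfpos : 0 < f := lt_of_lt_of_le (by positivity) hfD
  -- a uniform gap for supports far from those of `p`
  obtain ⟨μ, hμ1, hμ⟩ : ∃ μ < 1, ∀ l' ∈ wedgePolar K, -(κ / 2) ≤ wedge q l' →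
      wedge p l' ≤ μ := by
    have hT : IsCompact (wedgePolar K ∩ {l' | -(κ / 2) ≤ wedge q l'}) :=
      hK.isCompact_wedgePolar.inter_right (isClosed_le (by fun_prop) (by fun_prop))
    rcases (wedgePolar K ∩ {l' | -(κ / 2) ≤ wedge q l'}).eq_empty_or_nonempty with hE | hE
    · refine ⟨0, one_pos, fun l' h1 h2 => ?_⟩
      have : l' ∈ wedgePolar K ∩ {l' | -(κ / 2) ≤ wedge q l'} := ⟨h1, h2⟩
      rw [hE] at this
      exact this.elim
    · obtain ⟨l', ⟨h1, h2⟩, hmax⟩ := hT.exists_isMaxOn hE (f := fun l' => wedge p l')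
        (by fun_prop)
      refine ⟨wedge p l', lt_of_le_of_ne (hcrit.1.1 ▸ hK.wedge_le_gauge h1 p) fun h => ?_,
        fun l'' k1 k2 => hmax ⟨k1, k2⟩⟩
      have := hκK _ _ _ hcrit h1 h
      have h2' : -(κ / 2) ≤ wedge q l' := h2
      linarith
  have ev1 : ∀ᶠ v in 𝓝 (0 : ℝ × ℝ), 2 * ‖v‖ * L < 1 - μ :=
    (by fun_prop : Continuous fun v : ℝ × ℝ => 2 * ‖v‖ * L).tendsto' _ 0 (by simp)
      |>.eventually_lt_const (by linarith)
  have ev2 : ∀ᶠ v in 𝓝 (0 : ℝ × ℝ), 2 * ‖w v‖ * L < κ / 2 :=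
    (by fun_prop : Continuous fun v : ℝ × ℝ => 2 * ‖w v‖ * L).tendsto' _ 0 (by simp [hw0])
      |>.eventually_lt_const (by linarith)
  have ev3 : ∀ᶠ v in 𝓝 (0 : ℝ × ℝ), 2 * ‖v‖ * L < κ :=
    (by fun_prop : Continuous fun v : ℝ × ℝ => 2 * ‖v‖ * L).tendsto' _ 0 (by simp)
      |>.eventually_lt_const hκ
  have ev4 : ∀ᶠ v in 𝓝 (0 : ℝ × ℝ), 0 < wedge (p + v) (q + w v) :=
    (by fun_prop : Continuous fun v : ℝ × ℝ => wedge (p + v) (q + w v)).tendsto' _ D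
      (by simp [hw0, hpq]) |>.eventually_const_lt hDpos
  have hmain : ∀ᶠ v in 𝓝 (0 : ℝ × ℝ), 1 ≤ gauge K (p + v) → -(2 * A) * ‖v‖ ^ 2 ≤ wedge v m := by
    filter_upwards [ev1, ev2, ev3, ev4] with v h1 h2 h3 h4 hg
    have bd : ∀ x l', l' ∈ wedgePolar K → |wedge x l'| ≤ 2 * ‖x‖ * L := fun x l' h =>
      (abs_wedge_le _ _).trans (by gcongr; exact hLK _ h)
    have hadm : IsAdmissible K (p + v) (q + w v) := by
      obtain ⟨l₀, hl₀, e₀⟩ := hK.exists_mem_wedgePolar hg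
      have hq₀ : wedge q l₀ < -(κ / 2) := by
        by_contra! hcon
        have k1 := hμ l₀ hl₀ hcon
        have k2 := le_of_abs_le (bd v l₀ hl₀)
        rw [wedge_add_left] at e₀
        linarith
      have k3 := abs_le.1 (bd v l₄ hl₄)
      have k4 := le_of_abs_le (bd (w v) l₀ hl₀)
      have k5 := abs_le.1 (bd (w v) l₄ hl₄)
      refine hK.isAdmissible_of_polar hl₀ hl₂ (hK.neg_mem_wedgePolar hl₄) e₀.ge ?_ ?_ ?_ ?_ ?_
      · rw [wedge_add_left]; linarith
      · rw [wedge_add_left, e₂, hw2, add_zero]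
      · rw [wedge_neg_right, wedge_add_left, hp4]; linarith
      · rw [wedge_neg_right, wedge_add_left, hβ]; linarith
      · have := hw4 v
        rw [wedge_neg_right, wedge_add_left, wedge_add_left, wedge_add_left, hp4, hβ]
        linarith
    have k6 := hK.inscribedDet_le h4.ne' hadm
    rw [abs_of_pos h4, hF, ← hD] at k6
    have k7 := le_of_abs_le (abs_wedge_le v (w v))
    have k8 : 2 * ‖v‖ * ‖w v‖ ≤ 2 * ‖v‖ * (A * ‖v‖) := by gcongr; exact hnw v
    nlinarith
  have hlm : wedge l m = 0 := by
    by_contra hne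
    have hcont : Continuous fun t : ℝ => t • l := by fun_prop
    have e1 := (hcont.tendsto' 0 0 (zero_smul _ _)).eventually hmain
    have e2 : ∀ᶠ t : ℝ in 𝓝 0, |t| * (2 * A * ‖l‖ ^ 2) < |wedge l m| :=
      (by fun_prop : Continuous fun t : ℝ => |t| * (2 * A * ‖l‖ ^ 2)).tendsto' 0 0 (by simp)
        |>.eventually_lt_const (abs_pos.2 hne)
    obtain ⟨t, ht, ht0⟩ := ((e1.and e2).and
      ((continuous_neg (G := ℝ)).tendsto' 0 0 neg_zero |>.eventually e1)
      |>.filter_mono (nhdsWithin_le_nhds (s := Ioi 0)) |>.and self_mem_nhdsWithin).exists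
    have ht0' : (0 : ℝ) < t := ht0
    obtain ⟨⟨k1, k2⟩, k3⟩ := ht
    have hg : ∀ s : ℝ, 1 ≤ gauge K (p + s • l) := fun s => by
      have := hK.wedge_le_gauge hl (p + s • l)
      rwa [wedge_add_left, wedge_smul_left, wedge_self, hpl, mul_zero, add_zero] at this
    have k1' := k1 (hg _)
    have k3' := k3 (hg _)
    rw [wedge_smul_left, norm_smul, Real.norm_eq_abs, mul_pow, sq_abs] at k1' k3'
    rw [abs_of_pos ht0'] at k2
    have k9 := mul_lt_mul_of_pos_left k2 ht0'
    rcases abs_cases (wedge l m) with ⟨k, -⟩ | ⟨k, -⟩ <;> rw [k] at k9 <;> linarith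
  filter_upwards [hmain] with v hv hg
  have h1 := hv hg
  have h2 : wedge v m = wedge v l * f := by
    have := wedge_smul_eq p l v
    rw [hpl, one_smul] at this
    conv_lhs => rw [this]
    rw [wedge_add_left, wedge_smul_left, wedge_smul_left, hlm, mul_zero, add_zero]
  rw [h2] at h1
  have h3 : A / (κ ^ 2 * D) * (2 * κ ^ 2 * D) = 2 * A := by field_simp
  by_contra! hcon
  have h4 : wedge v l * f ≤ wedge v l * (2 * κ ^ 2 * D) := by
    refine mul_le_mul_of_nonpos_left hfD (hcon.le.trans ?_)
    have : 0 ≤ A / (κ ^ 2 * D) * ‖v‖ ^ 2 := by positivity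
    linarith
  have h5 : wedge v l * (2 * κ ^ 2 * D) < -(A / (κ ^ 2 * D)) * ‖v‖ ^ 2 * (2 * κ ^ 2 * D) :=
    mul_lt_mul_of_pos_right hcon (by positivity)
  have h6 : -(A / (κ ^ 2 * D)) * ‖v‖ ^ 2 * (2 * κ ^ 2 * D) = -(2 * A) * ‖v‖ ^ 2 := by
    rw [← h3]; ring
  linarith

/-- Near a vertex of a minimal inscribed hexagon, the complement of `K` lies above a parabola
with universal constant. -/
lemma exists_eventually_neg_le_wedge (hK : IsCSCD K) (hU : HasUniqueSupport K) :
    ∃ C : ℝ, 0 < C ∧ ∀ p q l, IsCritical K p q → l ∈ wedgePolar K → wedge p l = 1 →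
      ∀ᶠ v in 𝓝 (0 : ℝ × ℝ), 1 ≤ gauge K (p + v) → -C * ‖v‖ ^ 2 ≤ wedge v l := by
  obtain ⟨κ, hκ, hκK⟩ := hK.exists_wedge_le_neg hU
  obtain ⟨R, hR, hRK⟩ := hK.exists_norm_le
  obtain ⟨L, hL, hLK⟩ := hK.exists_polar_bound
  have hD := hK.inscribedDet_pos
  refine ⟨4 * R * L / κ / (κ ^ 2 * inscribedDet K), by positivity, fun p q l h hl hpl => ?_⟩
  rcases lt_or_gt_of_ne (hK.wedge_ne_zero_of_isInscribed h.1) with hneg | hpos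
  · refine hK.eventually_neg_le_wedge_of_pos hκ hR hL hRK hLK hκK (q := -(q + p))
      (h.symm.rotate hK) ?_ hl hpl
    rw [wedge_neg_right, wedge_add_right, wedge_self]
    linarith
  · exact hK.eventually_neg_le_wedge_of_pos hκ hR hL hRK hLK hκK h hpos hl hpl

end IsCSCD

namespace IsMiserly

variable {K : Set (ℝ × ℝ)}

/-- Supporting lines of a miserly domain vary in a uniformly Lipschitz manner. -/
lemma exists_eventually_abs_wedge_le (hM : IsMiserly K) (hU : HasUniqueSupport K) :
    ∃ C : ℝ, 0 < C ∧ ∀ p l, gauge K p = 1 → l ∈ wedgePolar K → wedge p l = 1 →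
      ∀ᶠ p' in 𝓝 p, ∀ l' ∈ wedgePolar K, gauge K p' = 1 → wedge p' l' = 1 →
        |wedge l l'| ≤ C * ‖p' - p‖ := by
  have hK := hM.1
  obtain ⟨C, hC, hCK⟩ := hK.exists_eventually_neg_le_wedge hU
  obtain ⟨R, hR, hRK⟩ := hK.exists_norm_le
  obtain ⟨L, hL, hLK⟩ := hK.exists_polar_bound
  set M := 25 * C * R ^ 2 * L ^ 2 + 1 with hMdef
  have hMpos : 0 < M := by positivity
  refine ⟨(M + C) / (2 * R), by positivity, fun p l hp hl hpl => ?_⟩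
  have hexp : ∀ x, x = wedge p x • l + wedge x l • p := fun x => by
    have := wedge_smul_eq p l x
    rw [hpl, one_smul] at this
    rwa [add_comm]
  by_cases hext : p ∈ K.extremePoints ℝ
  · obtain ⟨q, hq⟩ := hM.exists_critical hext
    obtain ⟨r, hr, hball⟩ := Metric.eventually_nhds_iff.1 (hCK p q l hq hl hpl)
    have ev1 : ∀ᶠ p' in 𝓝 p, ‖p' - p‖ < r :=
      (by fun_prop : Continuous fun p' : ℝ × ℝ => ‖p' - p‖).tendsto' p 0 (by simp)
        |>.eventually_lt_const hr
    have ev2 : ∀ᶠ p' in 𝓝 p, 5 * R * L * ‖p' - p‖ < r :=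
      (by fun_prop : Continuous fun p' : ℝ × ℝ => 5 * R * L * ‖p' - p‖).tendsto' p 0 (by simp)
        |>.eventually_lt_const hr
    have ev3 : ∀ᶠ p' in 𝓝 p, M * ‖p' - p‖ < L :=
      (by fun_prop : Continuous fun p' : ℝ × ℝ => M * ‖p' - p‖).tendsto' p 0 (by simp)
        |>.eventually_lt_const hL
    filter_upwards [ev1, ev2, ev3] with p' h1 h2 h3 l' hl' hp' hpl'
    obtain ⟨x, rfl⟩ : ∃ x, p' = p + x := ⟨p' - p, by simp⟩
    rw [add_sub_cancel_left] at *
    rcases eq_or_ne x 0 with rfl | hx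
    · rw [add_zero] at hpl'
      rw [hU p l l' hp hl hl' hpl hpl', wedge_self]
      simp
    have hd : 0 < ‖x‖ := norm_pos_iff.2 hx
    have hb : -C * ‖x‖ ^ 2 ≤ wedge x l := hball (by simpa using h1) hp'.ge
    have hb0 : wedge x l ≤ 0 := by
      have := hK.wedge_le_gauge hl (p + x)
      rw [wedge_add_left, hpl, hp'] at this
      linarith
    have hnp : ‖p‖ ≤ R := hRK _ (hK.gauge_le_one_iff.1 hp.le)
    have hnl : ‖l‖ ≤ L := hLK _ hl
    have ha : |wedge p x| ≤ 2 * R * ‖x‖ := (abs_wedge_le _ _).trans (by gcongr)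
    have htest : ∀ h : ℝ, |h| = 4 * R * ‖x‖ →
        (h - wedge p x) * wedge l l' ≤ (M + C) * ‖x‖ ^ 2 := by
      intro h hh
      set v := h • l - (M * ‖x‖ ^ 2) • p with hv
      have hvl : wedge v l = -(M * ‖x‖ ^ 2) := by
        rw [hv, wedge_sub_left, wedge_smul_left, wedge_smul_left, wedge_self, hpl]; ring
      have hnv : ‖v‖ ≤ 5 * R * L * ‖x‖ := by
        calc ‖v‖ ≤ ‖h • l‖ + ‖(M * ‖x‖ ^ 2) • p‖ := norm_sub_le _ _
          _ ≤ 4 * R * ‖x‖ * L + (L * ‖x‖) * R := by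
            rw [norm_smul, norm_smul, Real.norm_eq_abs, Real.norm_eq_abs, hh,
              abs_of_nonneg (by positivity : 0 ≤ M * ‖x‖ ^ 2)]
            have : M * ‖x‖ ^ 2 ≤ L * ‖x‖ := by nlinarith
            gcongr
          _ = _ := by ring
      have hlt : gauge K (p + v) < 1 := by
        by_contra! hge
        have hpar := hball (show dist v 0 < r by simpa using hnv.trans_lt h2) hge
        rw [hvl] at hpar
        have : C * ‖v‖ ^ 2 ≤ C * (5 * R * L * ‖x‖) ^ 2 := by gcongr
        have : 0 < ‖x‖ ^ 2 := by positivity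
        rw [hMdef] at hpar
        nlinarith
      have h4 := hK.wedge_le_gauge hl' (p + v)
      have h5 : wedge x l' = wedge p x * wedge l l' + wedge x l * wedge p l' := by
        conv_lhs => rw [hexp x]
        rw [wedge_add_left, wedge_smul_left, wedge_smul_left]
      rw [hv, wedge_add_left, wedge_sub_left, wedge_smul_left, wedge_smul_left] at h4
      rw [wedge_add_left, h5] at hpl'
      have h6 := abs_le.1 (hK.abs_wedge_le_gauge hl' p)
      rw [hp] at h6
      have h7 : (M * ‖x‖ ^ 2 + wedge x l) * wedge p l' ≤ M * ‖x‖ ^ 2 + C * ‖x‖ ^ 2 := by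
        have : 0 < M * ‖x‖ ^ 2 := by positivity
        have : 0 < C * ‖x‖ ^ 2 := by positivity
        rcases le_total 0 (M * ‖x‖ ^ 2 + wedge x l) with hs | hs <;> nlinarith
      linarith
    have ha' := abs_le.1 ha
    have h4R : (0 : ℝ) ≤ 4 * R * ‖x‖ := by positivity
    have hfin : 2 * R * ‖x‖ * |wedge l l'| ≤ (M + C) * ‖x‖ ^ 2 := by
      rcases abs_cases (wedge l l') with ⟨e, hs⟩ | ⟨e, hs⟩
      · refine le_trans ?_ (htest (4 * R * ‖x‖) (abs_of_nonneg h4R))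
        rw [e]
        exact mul_le_mul_of_nonneg_right (by linarith) hs
      · refine le_trans ?_ (htest (-(4 * R * ‖x‖)) (by rw [abs_neg, abs_of_nonneg h4R]))
        rw [e, mul_neg, ← neg_mul]
        exact mul_le_mul_of_nonpos_right (by linarith) hs.le
    rw [div_mul_eq_mul_div, le_div_iff₀ (by positivity)]
    refine le_of_mul_le_mul_right ?_ hd
    linarith
  · have hpK := hK.gauge_le_one_iff.1 hp.le
    obtain ⟨γ₀, hγ₀, hseg⟩ : ∃ γ₀ : ℝ, 0 < γ₀ ∧ ∀ γ : ℝ, |γ| ≤ γ₀ → p + γ • l ∈ K := by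
      rw [mem_extremePoints_iff_left] at hext
      push Not at hext
      obtain ⟨a, haK, b, hbK, ⟨θ, η, hθ, hη, hs, hab⟩, hap⟩ := hext hpK
      set d := a - p with hd
      have hd0 : d ≠ 0 := sub_ne_zero.2 hap
      have hb : η • (b - p) = -(θ • d) := by
        have : θ • a + η • b = (θ + η) • p := by rw [hs, one_smul, hab]
        rw [add_smul] at this
        rw [hd, smul_sub, smul_sub, neg_sub]
        rw [← sub_eq_zero] at this ⊢
        rw [← this]
        abel
      have hmem : ∀ γ : ℝ, |γ| ≤ θ → p + γ • d ∈ K := by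
        intro γ hγ
        rw [abs_le] at hγ
        rcases le_total 0 γ with h0 | h0
        · have := hK.1.add_smul_sub_mem hpK haK (t := γ) ⟨h0, by linarith⟩
          exact this
        · have := hK.1.add_smul_sub_mem hpK hbK (t := -γ / θ * η)
            ⟨mul_nonneg (div_nonneg (by linarith) hθ.le) hη.le, by
              have : -γ / θ ≤ 1 := (div_le_one hθ).2 (by linarith)
              have : 0 ≤ -γ / θ := div_nonneg (by linarith) hθ.le
              nlinarith⟩
          rw [mul_smul, hb, smul_neg, smul_smul, div_mul_cancel₀ _ hθ.ne', neg_smul, neg_neg] at this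
          exact this
      have hdl : wedge d l = 0 := by
        have h1 := hl _ (hmem θ (abs_of_pos hθ).le)
        have h2 := hl _ (hmem (-θ) (by rw [abs_neg, abs_of_pos hθ]))
        rw [wedge_add_left, wedge_smul_left, hpl] at h1 h2
        nlinarith
      have hdexp := hexp d
      rw [hdl, zero_smul, add_zero] at hdexp
      have hpd : wedge p d ≠ 0 := by
        intro h0
        rw [h0, zero_smul] at hdexp
        exact hd0 hdexp
      refine ⟨θ * |wedge p d|, mul_pos hθ (abs_pos.2 hpd), fun γ hγ => ?_⟩
      have := hmem (γ / wedge p d) (by rwa [abs_div, div_le_iff₀ (abs_pos.2 hpd)])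
      rwa [hdexp, smul_smul, ← hdexp, div_mul_cancel₀ _ hpd] at this
    have ev1 : ∀ᶠ p' in 𝓝 p, 1 / 2 < wedge p' l :=
      (by fun_prop : Continuous fun p' : ℝ × ℝ => wedge p' l).tendsto' p 1 hpl
        |>.eventually_const_lt (by norm_num)
    have ev2 : ∀ᶠ p' in 𝓝 p, |wedge p p'| < γ₀ / 2 :=
      (by fun_prop : Continuous fun p' : ℝ × ℝ => |wedge p p'|).tendsto' p 0
        (by simp [wedge_self]) |>.eventually_lt_const (by positivity)
    filter_upwards [ev1, ev2] with p' h1 h2 l' hl' hp' hpl'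
    have hle : wedge p' l ≤ 1 := hp' ▸ hK.wedge_le_gauge hl p'
    have heq : wedge p' l = 1 := by
      refine le_antisymm hle ?_
      have hpos : 0 < wedge p' l := by linarith
      have hmem := hseg (wedge p p' / wedge p' l) (by
        rw [abs_div, abs_of_pos hpos, div_le_iff₀ hpos]
        nlinarith)
      have : p' = wedge p' l • (p + (wedge p p' / wedge p' l) • l) := by
        conv_lhs => rw [hexp p']
        rw [smul_add, smul_smul, mul_div_cancel₀ _ hpos.ne', add_comm]
      rw [this, hK.gauge_smul, abs_of_pos hpos] at hp'
      have := hK.gauge_le_one_iff.2 hmem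
      nlinarith
    rw [hU p' l l' hp' hl hl' heq hpl', wedge_self]
    simp only [abs_zero]
    positivity

end IsMiserly

/-- A continuous map that is locally Lipschitz at each point with a common constant is Lipschitz. -/
lemma lipschitzWith_of_eventually_norm_sub_le {E : Type*} [NormedAddCommGroup E] {f : ℝ → E}
    {C : ℝ} (hC : 0 ≤ C) (hf : Continuous f)
    (h : ∀ t, ∀ᶠ s in 𝓝 t, ‖f s - f t‖ ≤ C * |s - t|) : LipschitzWith (C + 1).toNNReal f := by
  have key : ∀ a b, a ≤ b → ‖f b - f a‖ ≤ (C + 1) * (b - a) := by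
    intro a b hab
    refine image_norm_le_of_liminf_right_slope_norm_lt_deriv_boundary (f := fun x => f x - f a)
      (f' := fun _ => C) (B := fun x => (C + 1) * (x - a)) (B' := fun _ => C + 1) (b := b)
      (by fun_prop) ?_ (by simp) (by fun_prop) ?_ (fun _ _ _ => by simp) ⟨hab, le_rfl⟩
    · intro x _ r hr
      refine Eventually.frequently ?_
      filter_upwards [(h x).filter_mono nhdsWithin_le_nhds, self_mem_nhdsWithin] with z hz hzx
      have hzx' : 0 < z - x := sub_pos.2 hzx
      rw [abs_of_pos hzx'] at hz
      refine lt_of_le_of_lt ?_ hr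
      rw [slope_def_field, div_le_iff₀ hzx']
      refine le_trans ?_ hz
      have := norm_sub_norm_le (f z - f a) (f x - f a)
      rwa [sub_sub_sub_cancel_right] at this
    · intro x _
      simpa using (((hasDerivAt_id x).sub_const a).const_mul (C + 1)).hasDerivWithinAt
  refine LipschitzWith.of_dist_le_mul fun x y => ?_
  rw [Real.coe_toNNReal _ (by linarith), Real.dist_eq]
  rcases le_total x y with hxy | hxy
  · rw [dist_comm, dist_eq_norm, abs_sub_comm, abs_of_nonneg (sub_nonneg.2 hxy)]
    exact key x y hxy
  · rw [dist_eq_norm, abs_of_nonneg (sub_nonneg.2 hxy)]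
    exact key y x hxy

/-- A supporting line at a point of a boundary curve is directed along the tangent. -/
lemma smul_support_eq_deriv {K : Set (ℝ × ℝ)} (hK : IsCSCD K) {σ : ℝ → ℝ × ℝ}
    (hσ : Differentiable ℝ σ) (hg : ∀ t, gauge K (σ t) = 1) {t : ℝ} {l : ℝ × ℝ}
    (hl : l ∈ wedgePolar K) (h : wedge (σ t) l = 1) :
    wedge (σ t) (deriv σ t) • l = deriv σ t := by
  have hd : HasDerivAt (fun s => wedge (σ s) l) (wedge (deriv σ t) l) t := by
    have h1 := (hσ t).hasDerivAt
    exact ((hasFDerivAt_fst.comp_hasDerivAt t h1).mul_const l.2).sub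
      ((hasFDerivAt_snd.comp_hasDerivAt t h1).mul_const l.1)
  have hmax : IsLocalMax (fun s => wedge (σ s) l) t := Eventually.of_forall fun s => by
    have := hK.wedge_le_gauge hl (σ s)
    rw [hg] at this
    exact this.trans h.ge
  have h0 := hmax.hasDerivAt_eq_zero hd
  rw [wedge_smul_eq (σ t) (deriv σ t) l, h, wedge_comm_neg, h0, neg_zero, zero_smul, one_smul,
    zero_add]

/-- Let `K` be a miserly domain and `σ₀ : ℝ → ℝ × ℝ` a C¹ arclength parametrization
of the boundary of `K`.  Then `σ₀'` is Lipschitz continuous. -/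
theorem miserly_boundary_deriv_lipschitz (K : Set (ℝ × ℝ)) (hK : IsMiserly K)
    (σ₀ : ℝ → ℝ × ℝ)
    (hdiff : Differentiable ℝ σ₀) (hC1 : Continuous (deriv σ₀))
    (harc : ∀ t : ℝ, ‖deriv σ₀ t‖ = 1)
    (hrange : Set.range σ₀ = frontier K) :
    ∃ c : NNReal, LipschitzWith c (deriv σ₀) := by
  have hC := hK.1
  have hg : ∀ t, gauge K (σ₀ t) = 1 := fun t =>
    hC.gauge_eq_one_iff.2 (hrange ▸ mem_range_self t)
  have hsup := fun t (l : ℝ × ℝ) => smul_support_eq_deriv hC hdiff hg (t := t) (l := l)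
  have hne : ∀ t, wedge (σ₀ t) (deriv σ₀ t) ≠ 0 := by
    intro t h0
    obtain ⟨l, hl, e⟩ := hC.exists_mem_wedgePolar (hg t).ge
    have h1 := hsup t l hl e
    rw [h0, zero_smul] at h1
    have h2 := harc t
    rw [← h1, norm_zero] at h2
    exact zero_ne_one h2
  have hU : HasUniqueSupport K := by
    intro p l l' hp hl hl' e e'
    obtain ⟨t, rfl⟩ : p ∈ range σ₀ := hrange ▸ hC.gauge_eq_one_iff.1 hp
    exact smul_right_injective _ (hne t) ((hsup t l hl e).trans (hsup t l' hl' e').symm)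
  obtain ⟨C, hCpos, hCK⟩ := hK.exists_eventually_abs_wedge_le hU
  obtain ⟨R, hR, hRK⟩ := hC.exists_norm_le
  have hdet : ∀ t, |wedge (σ₀ t) (deriv σ₀ t)| ≤ 2 * R := fun t => by
    have h1 := abs_wedge_le (σ₀ t) (deriv σ₀ t)
    rw [harc, mul_one] at h1
    exact h1.trans (by gcongr; exact hRK _ (hC.gauge_le_one_iff.1 (hg t).le))
  have hlip : ∀ s t, ‖σ₀ s - σ₀ t‖ ≤ |s - t| := fun s t => by
    have := convex_univ.norm_image_sub_le_of_norm_deriv_le (C := 1) (f := σ₀) (x := t) (y := s)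
      (fun x _ => hdiff x) (fun x _ => (harc x).le) (mem_univ _) (mem_univ _)
    rwa [one_mul, Real.norm_eq_abs] at this
  refine ⟨_, lipschitzWith_of_eventually_norm_sub_le
    (C := 2 * R * (2 * R) * C) (by positivity) hC1 fun t => ?_⟩
  obtain ⟨l, hl, e⟩ := hC.exists_mem_wedgePolar (hg t).ge
  have hnear : ∀ᶠ s in 𝓝 t, ‖deriv σ₀ s - deriv σ₀ t‖ < 1 :=
    (by fun_prop : Continuous fun s => ‖deriv σ₀ s - deriv σ₀ t‖).tendsto' t 0 (by simp)
      |>.eventually_lt_const one_pos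
  filter_upwards [hnear, (hdiff t).continuousAt.eventually (hCK _ l (hg t) hl e)] with s h1 h2
  obtain ⟨l', hl', e'⟩ := hC.exists_mem_wedgePolar (hg s).ge
  refine (norm_sub_le_abs_wedge (harc t) (harc s) h1).trans ?_
  have h3 := h2 l' hl' (hg s) e'
  rw [← hsup t l hl e, ← hsup s l' hl' e', wedge_smul_left, wedge_smul_right, abs_mul, abs_mul]
  calc _ ≤ 2 * R * (2 * R * (C * |s - t|)) := by
        gcongr
        · exact hdet t
        · exact hdet s
        · exact h3.trans (by gcongr; exact hlip s t)
    _ = _ := by ring
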